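/- Let M ∈ [1,∞), L ∈ [1/2,∞), ϑ ∈ ℝ₊ and k ∈ ℤ₊. Then the number of quadruples ⟨a,b,c,d⟩ of integers with a, b, c, d ∈ (L, 2L] and |√a + √b − √c − √d| < k M^{ϑ − 1/2} is, for every fixed ε > 0, ≪ L^{7/2+ε} k M^{ϑ − 1/2} + L^{2+ε}, where the implicit constant depends only on ε. -/

import Mathlib

open scoped Real

open MeasureTheory in
theorem integral_unitCube_exp {ι : Type*} [Fintype ι] [DecidableEq ι] (n : ι → ℤ) :
    ∫ θ in Set.univ.pi (fun _ : ι => Set.Ico (0 : ℝ) 1),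
      Complex.exp (2 * π * Complex.I * ∑ i, (n i : ℂ) * (θ i : ℂ)) =
      if n = 0 then 1 else 0 := by
  have one_dim (m : ℤ) : ∫ t in Set.Ico (0 : ℝ) 1,
      Complex.exp (2 * π * Complex.I * ((m : ℂ) * (t : ℂ))) = if m = 0 then 1 else 0 := by
    rw [integral_Ico_eq_integral_Ioc, ← intervalIntegral.integral_of_le zero_le_one]
    split_ifs with hm
    · simp [hm]
    · have hc : (2 * π * Complex.I * m : ℂ) ≠ 0 := by
        simp [hm, Real.pi_ne_zero]
      simp_rw [← mul_assoc]
      rw [integral_exp_mul_complex hc]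
      have : (2 * π * Complex.I * m : ℂ) * ((1 : ℝ) : ℂ) = m * (2 * π * Complex.I) := by
        push_cast; ring
      rw [this, Complex.exp_int_mul_two_pi_mul_I]
      simp
  rw [volume_pi, Measure.restrict_pi_pi]
  simp_rw [Finset.mul_sum, Complex.exp_sum]
  rw [integral_fintype_prod_eq_prod
    (f := fun i (t : ℝ) => Complex.exp (2 * π * Complex.I * ((n i : ℂ) * (t : ℂ))))]
  simp_rw [one_dim]
  split_ifs with hn
  · simp [hn]
  · obtain ⟨i, hi⟩ := Function.ne_iff.mp hn
    exact Finset.prod_eq_zero (Finset.mem_univ i) (if_neg hi)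

/-- The exponential sum over a finite set of lattice points. -/
noncomputable def latticeExpSum {ι : Type*} [Fintype ι] (S : Finset (ι → ℤ)) (θ : ι → ℝ) : ℂ :=
  ∑ y ∈ S, Complex.exp (2 * π * Complex.I * ∑ i, (y i : ℂ) * (θ i : ℂ))

theorem continuous_latticeExpSum {ι : Type*} [Fintype ι] (S : Finset (ι → ℤ)) :
    Continuous (latticeExpSum S) := by
  unfold latticeExpSum
  fun_prop

theorem latticeExpSum_add_int {ι : Type*} [Fintype ι] (S : Finset (ι → ℤ)) (θ : ι → ℝ)
    (k : ι → ℤ) : latticeExpSum S (fun i => k i + θ i) = latticeExpSum S θ := by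
  unfold latticeExpSum
  refine Finset.sum_congr rfl fun y _ => ?_
  rw [← Complex.exp_periodic.int_mul (∑ i, y i * k i)
    (2 * π * Complex.I * ∑ i, (y i : ℂ) * (θ i : ℂ))]
  congr 1
  push_cast
  simp_rw [mul_add, Finset.sum_add_distrib]
  ring

open MeasureTheory in
theorem integral_unitCube_normSq_latticeExpSum {ι : Type*} [Fintype ι] [DecidableEq ι]
    (S : Finset (ι → ℤ)) :
    ∫ θ in Set.univ.pi (fun _ : ι => Set.Ico (0 : ℝ) 1), ‖latticeExpSum S θ‖ ^ 2 = S.card := by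
  have expand (θ : ι → ℝ) : ((‖latticeExpSum S θ‖ ^ 2 : ℝ) : ℂ) =
      ∑ y ∈ S, ∑ z ∈ S, Complex.exp (2 * π * Complex.I * ∑ i, ((y - z) i : ℤ) * (θ i : ℂ)) := by
    rw [Complex.ofReal_pow, ← Complex.mul_conj', latticeExpSum, map_sum, Finset.sum_mul_sum]
    refine Finset.sum_congr rfl fun y _ => Finset.sum_congr rfl fun z _ => ?_
    rw [← Complex.exp_conj, ← Complex.exp_add]
    congr 1
    simp only [map_mul, map_sum, Complex.conj_ofReal, Complex.conj_I, map_intCast, map_ofNat,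
      Pi.sub_apply, Int.cast_sub, sub_mul, Finset.sum_sub_distrib]
    ring
  have hfin : volume (Set.univ.pi (fun _ : ι => Set.Ico (0 : ℝ) 1)) ≠ ⊤ := by
    rw [Real.volume_pi_Ico]; simp
  have integrable (n : ι → ℤ) : IntegrableOn (fun θ : ι → ℝ =>
      Complex.exp (2 * π * Complex.I * ∑ i, (n i : ℂ) * (θ i : ℂ)))
      (Set.univ.pi (fun _ : ι => Set.Ico (0 : ℝ) 1)) := by
    refine Measure.integrableOn_of_bounded (M := 1) hfin
      (Continuous.aestronglyMeasurable (by fun_prop)) (Filter.Eventually.of_forall fun θ => ?_)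
    have : (2 * π * Complex.I * ∑ i, (n i : ℂ) * (θ i : ℂ)) =
        ((2 * π * ∑ i, (n i : ℝ) * θ i : ℝ) : ℂ) * Complex.I := by push_cast; ring
    rw [this, Complex.norm_exp_ofReal_mul_I]
  have key : ((∫ θ in Set.univ.pi (fun _ : ι => Set.Ico (0 : ℝ) 1),
      ‖latticeExpSum S θ‖ ^ 2 : ℝ) : ℂ) = S.card := by
    rw [← integral_complex_ofReal]
    simp_rw [expand]
    rw [integral_finsetSum _ fun y _ => integrable_finsetSum _ fun z _ => integrable (y - z)]
    simp_rw [integral_finsetSum S fun z _ => integrable (_ - z), integral_unitCube_exp, sub_eq_zero]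
    simp
  exact_mod_cast key

open MeasureTheory in
/-- Folding a set whose integral differences lie in `T` onto the unit cube. -/
theorem setLIntegral_le_card_mul_unitCube {ι : Type*} [Fintype ι] [DecidableEq ι]
    (E : Set (ι → ℝ)) (hE : MeasurableSet E) (T : Finset (ι → ℤ))
    (hT : ∀ x ∈ E, ∀ y ∈ E, ∀ k : ι → ℤ, (∀ i, x i - y i = k i) → k ∈ T)
    (f : (ι → ℝ) → ENNReal) (hf : Measurable f)
    (hper : ∀ θ (k : ι → ℤ), f (fun i => k i + θ i) = f θ) :
    ∫⁻ θ in E, f θ ≤ T.card * ∫⁻ θ in Set.univ.pi (fun _ : ι => Set.Ico (0 : ℝ) 1), f θ := by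
  have fd := ZSpan.isAddFundamentalDomain' (Pi.basisFun ℝ ι) (volume : Measure (ι → ℝ))
  rw [ZSpan.fundamentalDomain_pi_basisFun] at fd
  have coords (g : (Submodule.span ℤ (Set.range (Pi.basisFun ℝ ι))).toAddSubgroup) :
      ∃ k : ι → ℤ, ∀ i, (g : ι → ℝ) i = k i := by
    have := (Module.Basis.mem_span_iff_repr_mem ℤ (Pi.basisFun ℝ ι) (g : ι → ℝ)).mp g.2
    choose k hk using this
    exact ⟨k, fun i => by simpa using (hk i).symm⟩
  choose k hk using coords
  have hk_inj : Function.Injective k := fun g g' h => by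
    ext i
    rw [hk, hk, h]
  have := hk_inj.countable
  rw [← lintegral_indicator hE, fd.lintegral_eq_tsum']
  have shift (g : (Submodule.span ℤ (Set.range (Pi.basisFun ℝ ι))).toAddSubgroup) (x : ι → ℝ) :
      E.indicator f (-g +ᵥ x) = E.indicator 1 (-g +ᵥ x) * f x := by
    have : f (-g +ᵥ x) = f x := by
      rw [← hper x (k (-g))]
      congr 1
      ext i
      rw [← hk]
      rfl
    by_cases hx : -g +ᵥ x ∈ E <;> simp [hx, this]
  simp_rw [shift]
  have hmeas (g : (Submodule.span ℤ (Set.range (Pi.basisFun ℝ ι))).toAddSubgroup) :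
      Measurable fun x : ι → ℝ => E.indicator (1 : (ι → ℝ) → ENNReal) (-g +ᵥ x) :=
    (measurable_one.indicator hE).comp (measurable_const_vadd (-g))
  rw [← lintegral_tsum
    (f := fun (g : (Submodule.span ℤ (Set.range (Pi.basisFun ℝ ι))).toAddSubgroup) (x : ι → ℝ) =>
      E.indicator (1 : (ι → ℝ) → ENNReal) (-g +ᵥ x) * f x)
    fun g => ((hmeas g).mul hf).aemeasurable]
  simp_rw [ENNReal.tsum_mul_right]
  rw [← lintegral_const_mul _ hf]
  refine lintegral_mono fun x => mul_le_mul_left ?_ _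
  have : ∑' g : (Submodule.span ℤ (Set.range (Pi.basisFun ℝ ι))).toAddSubgroup,
      E.indicator (1 : (ι → ℝ) → ENNReal) (-g +ᵥ x) =
      ({g | -g +ᵥ x ∈ E} :
        Set ((Submodule.span ℤ (Set.range (Pi.basisFun ℝ ι))).toAddSubgroup)).encard := by
    rw [← ENNReal.tsum_set_one, tsum_subtype _ fun _ => (1 : ENNReal)]
    rfl
  rw [this, ← ENat.toENNReal_coe, ENat.toENNReal_le]
  by_cases hne : ({g | -g +ᵥ x ∈ E} :
      Set ((Submodule.span ℤ (Set.range (Pi.basisFun ℝ ι))).toAddSubgroup)).Nonempty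
  · obtain ⟨g₀, hg₀⟩ := hne
    rw [← Set.encard_coe_eq_coe_finsetCard T]
    refine Set.encard_le_encard_of_injOn (f := fun g i => k g₀ i - k g i) ?_ ?_
    · intro g hg
      refine hT _ hg _ hg₀ _ fun i => ?_
      change (-(g : ι → ℝ) i + x i) - (-(g₀ : ι → ℝ) i + x i) = _
      rw [hk, hk]
      push_cast
      ring
    · exact fun g _ g' _ h => hk_inj (funext fun i => sub_right_injective (congrFun h i))
  · rw [Set.not_nonempty_iff_eq_empty.mp hne]
    simp

open MeasureTheory in
/-- A transference inequality: the lattice points in a parallelepiped are bounded in number by its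
volume times the number of lattice points in the dual parallelepiped. -/
theorem card_le_of_dual_card {ι : Type*} [Fintype ι] [DecidableEq ι] [Nonempty ι]
    (A : Matrix ι ι ℝ) (b : ι → ℝ) (hb : ∀ i, 0 < b i)
    (S T : Finset (ι → ℤ))
    (hS : ∀ y ∈ S, ∀ i, |∑ j, A i j * y j| ≤ b i)
    (hT : ∀ (ξ : ι → ℤ) (s : ι → ℝ), (∀ i, |s i| ≤ 1 / (4 * Fintype.card ι * b i)) →
      (∀ j, (ξ j : ℝ) = ∑ i, s i * A i j) → ξ ∈ T) :
    (S.card : ℝ) * |A.det| ≤ 4 * (∏ i, (4 * Fintype.card ι * b i)) * T.card := by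
  set N : ℝ := (Fintype.card ι : ℝ) with hN
  have hNpos : 0 < N := by rw [hN]; exact_mod_cast Fintype.card_pos
  let h : ι → ℝ := fun i => 1 / (8 * N * b i)
  have hh (i : ι) : 0 < h i := by have := hb i; positivity
  let E : Set (ι → ℝ) := Matrix.toLin' A.transpose '' Set.Icc (-h) h
  have hvol : volume E = ENNReal.ofReal (|A.det| * ∏ i, (2 * h i)) := by
    rw [Measure.addHaar_image_linearMap, LinearMap.det_toLin', Matrix.det_transpose,
      Real.volume_Icc_pi, ENNReal.ofReal_mul (abs_nonneg _),
      ENNReal.ofReal_prod_of_nonneg fun i _ => by have := hh i; positivity]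
    congr 2
    ext i
    congr 1
    simp
    ring
  have hEmeas : MeasurableSet E :=
    (isCompact_Icc.image (LinearMap.continuous_of_finiteDimensional _)).measurableSet
  have hEapp (s : ι → ℝ) (j : ι) : Matrix.toLin' A.transpose s j = ∑ i, s i * A i j := by
    simp [Matrix.mulVec, dotProduct, mul_comm]
  have lower : ∀ θ ∈ E, (S.card : ℝ) / 2 ≤ ‖latticeExpSum S θ‖ := by
    rintro _ ⟨s, hs, rfl⟩
    refine le_trans ?_ (Complex.re_le_norm _)
    rw [latticeExpSum, Complex.re_sum, div_eq_mul_one_div, ← nsmul_eq_mul]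
    refine Finset.card_nsmul_le_sum _ _ _ fun y hy => ?_
    have hphase : |∑ i, (y i : ℝ) * Matrix.toLin' A.transpose s i| ≤ 1 / 8 := by
      have : ∑ i, (y i : ℝ) * Matrix.toLin' A.transpose s i = ∑ i, s i * ∑ j, A i j * y j := by
        simp_rw [hEapp, Finset.mul_sum]
        rw [Finset.sum_comm]
        exact Finset.sum_congr rfl fun i _ => Finset.sum_congr rfl fun j _ => by ring
      rw [this]
      calc |∑ i, s i * ∑ j, A i j * y j| ≤ ∑ i, |s i * ∑ j, A i j * y j| :=
            Finset.abs_sum_le_sum_abs _ _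
        _ ≤ ∑ _i : ι, 1 / (8 * N) := by
            refine Finset.sum_le_sum fun i _ => ?_
            rw [abs_mul]
            have h1 : |s i| ≤ h i := abs_le.mpr ⟨hs.1 i, hs.2 i⟩
            calc _ ≤ h i * b i := mul_le_mul h1 (hS y hy i) (abs_nonneg _) (hh i).le
              _ = _ := by have := (hb i).ne'; simp only [h]; field_simp
        _ = 1 / 8 := by
            rw [Finset.sum_const, Finset.card_univ, nsmul_eq_mul, ← hN]; field_simp
    have : (2 * π * Complex.I * ∑ i, (y i : ℂ) * (Matrix.toLin' A.transpose s i : ℂ)) =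
        ((2 * π * ∑ i, (y i : ℝ) * Matrix.toLin' A.transpose s i : ℝ) : ℂ) * Complex.I := by
      push_cast; ring
    rw [this, Complex.exp_ofReal_mul_I_re]
    rw [← Real.cos_abs, abs_mul, abs_of_pos Real.two_pi_pos, ← Real.cos_pi_div_three]
    refine Real.cos_le_cos_of_nonneg_of_le_pi (by positivity) (by linarith [Real.pi_pos]) ?_
    nlinarith [Real.pi_pos]
  have fold := setLIntegral_le_card_mul_unitCube E hEmeas T ?_
    (fun θ => ENNReal.ofReal (‖latticeExpSum S θ‖ ^ 2))
    (((continuous_latticeExpSum S).norm.pow 2).measurable.ennreal_ofReal)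
    (fun θ k => by rw [latticeExpSum_add_int])
  · have hint : IntegrableOn (fun θ => ‖latticeExpSum S θ‖ ^ 2)
        (Set.univ.pi (fun _ : ι => Set.Ico (0 : ℝ) 1)) := by
      refine (ContinuousOn.integrableOn_compact (μ := volume) isCompact_Icc
        ((continuous_latticeExpSum S).norm.pow 2).continuousOn
        (K := Set.Icc (0 : ι → ℝ) 1)).mono_set ?_
      intro x hx
      exact ⟨fun i => (hx i trivial).1, fun i => (hx i trivial).2.le⟩
    rw [← ofReal_integral_eq_lintegral_ofReal hint
      (Filter.Eventually.of_forall fun θ => by positivity),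
      integral_unitCube_normSq_latticeExpSum] at fold
    have low : ENNReal.ofReal (((S.card : ℝ) / 2) ^ 2) * volume E ≤
        ∫⁻ θ in E, ENNReal.ofReal (‖latticeExpSum S θ‖ ^ 2) := by
      rw [← setLIntegral_const]
      refine setLIntegral_mono' hEmeas fun θ hθ => ENNReal.ofReal_le_ofReal ?_
      exact pow_le_pow_left₀ (by positivity) (lower θ hθ) 2
    have comb := low.trans fold
    rw [hvol, ← ENNReal.ofReal_mul (by positivity), ← ENNReal.ofReal_natCast (n := T.card),
      ← ENNReal.ofReal_mul (by positivity), ENNReal.ofReal_le_ofReal_iff (by positivity)] at comb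
    have hprod : (∏ i, (2 * h i)) * ∏ i, (4 * N * b i) = 1 := by
      rw [← Finset.prod_mul_distrib]
      refine Finset.prod_eq_one fun i _ => ?_
      have := (hb i).ne'
      simp only [h]
      field_simp
      norm_num
    rcases (Nat.cast_nonneg (α := ℝ) S.card).eq_or_lt with h0 | hpos
    · rw [← h0, zero_mul]
      exact mul_nonneg (mul_nonneg (by norm_num) (Finset.prod_nonneg fun i _ => by
        have := hb i; positivity)) (by positivity)
    · have comb' : (S.card : ℝ) * (|A.det| * ∏ i, (2 * h i)) ≤ 4 * T.card := by
        refine le_of_mul_le_mul_left ?_ hpos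
        nlinarith
      have hP : 0 ≤ ∏ i, (4 * N * b i) := Finset.prod_nonneg fun i _ => by
        have := hb i; positivity
      calc (S.card : ℝ) * |A.det|
          = (S.card : ℝ) * (|A.det| * ∏ i, (2 * h i)) * ∏ i, (4 * N * b i) := by
            rw [← mul_assoc, mul_assoc, hprod, mul_one]
        _ ≤ 4 * T.card * ∏ i, (4 * N * b i) := mul_le_mul_of_nonneg_right comb' hP
        _ = _ := by ring
  · rintro _ ⟨s, hs, rfl⟩ _ ⟨t, ht, rfl⟩ k hk
    refine hT k (s - t) (fun i => ?_) fun j => ?_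
    · have : 1 / (4 * N * b i) = 2 * h i := by
        have := (hb i).ne'
        simp only [h]
        field_simp
        norm_num
      rw [this, abs_le]
      have := hs.1 i
      have := hs.2 i
      have := ht.1 i
      have := ht.2 i
      simp only [Pi.neg_apply, Pi.sub_apply] at *
      constructor <;> linarith
    · rw [← hk, hEapp, hEapp, ← Finset.sum_sub_distrib]
      exact Finset.sum_congr rfl fun i _ => by simp [sub_mul]

theorem rpow_mem_Icc_of_mem_Icc {κ s : ℝ} (a : ℝ) (hκ : 1 ≤ κ) (hs : s ∈ Set.Icc κ⁻¹ κ) :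
    s ^ a ∈ Set.Icc (κ ^ |a|)⁻¹ (κ ^ |a|) := by
  have hκ0 : 0 < κ := by linarith
  have hs0 : 0 < s := (inv_pos.mpr hκ0).trans_le hs.1
  rcases le_total 0 a with ha | ha
  · rw [abs_of_nonneg ha, ← Real.inv_rpow hκ0.le]
    exact ⟨Real.rpow_le_rpow (by positivity) hs.1 ha, Real.rpow_le_rpow hs0.le hs.2 ha⟩
  · rw [abs_of_nonpos ha, Real.rpow_neg hκ0.le, inv_inv]
    refine ⟨Real.rpow_le_rpow_of_nonpos hs0 hs.2 ha, ?_⟩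
    rw [← Real.inv_rpow hκ0.le]
    exact Real.rpow_le_rpow_of_nonpos (by positivity) hs.1 ha

theorem one_le_rpow_abs {κ : ℝ} (a : ℝ) (hκ : 1 ≤ κ) : 1 ≤ κ ^ |a| :=
  Real.one_le_rpow hκ (abs_nonneg a)

theorem exists_rpow_lipschitz (a : ℝ) {κ : ℝ} (hκ : 1 ≤ κ) :
    ∃ C : ℝ, 0 < C ∧ ∀ s ∈ Set.Icc κ⁻¹ κ, ∀ t ∈ Set.Icc κ⁻¹ κ,
      |s ^ a - t ^ a| ≤ C * |s - t| := by
  have hκ0 : 0 < κ := by linarith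
  refine ⟨(|a| + 1) * κ ^ |a - 1|, by positivity, fun s hs t ht => ?_⟩
  have pos {x : ℝ} (hx : x ∈ Set.Icc κ⁻¹ κ) : x ≠ 0 :=
    ((inv_pos.mpr hκ0).trans_le hx.1).ne'
  refine Convex.norm_image_sub_le_of_norm_hasDerivWithin_le
    (f := fun x : ℝ => x ^ a) (f' := fun x => a * x ^ (a - 1))
    (fun x hx => (Real.hasDerivAt_rpow_const (Or.inl (pos hx))).hasDerivWithinAt)
    (fun x hx => ?_) (convex_Icc κ⁻¹ κ) ht hs
  have hb := rpow_mem_Icc_of_mem_Icc (a - 1) hκ hx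
  have h0 : 0 ≤ x ^ (a - 1) := le_trans (by positivity) hb.1
  rw [norm_mul, Real.norm_eq_abs, Real.norm_eq_abs, abs_of_nonneg h0]
  exact mul_le_mul (by linarith) hb.2 h0 (by positivity)

theorem exists_rpow_inverse_lipschitz {a : ℝ} (ha : a ≠ 0) {κ : ℝ} (hκ : 1 ≤ κ) :
    ∃ C : ℝ, 0 < C ∧ ∀ s ∈ Set.Icc κ⁻¹ κ, ∀ t ∈ Set.Icc κ⁻¹ κ,
      |s - t| ≤ C * |s ^ a - t ^ a| := by
  have hκ0 : 0 < κ := by linarith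
  obtain ⟨C, hC, h⟩ := exists_rpow_lipschitz a⁻¹ (one_le_rpow_abs a hκ)
  refine ⟨C, hC, fun s hs t ht => ?_⟩
  have := h _ (rpow_mem_Icc_of_mem_Icc a hκ hs) _ (rpow_mem_Icc_of_mem_Icc a hκ ht)
  rwa [Real.rpow_rpow_inv ((inv_pos.mpr hκ0).trans_le hs.1).le ha,
    Real.rpow_rpow_inv ((inv_pos.mpr hκ0).trans_le ht.1).le ha] at this

theorem exists_rpow_taylor (a : ℝ) {κ : ℝ} (hκ : 1 ≤ κ) :
    ∃ C : ℝ, 0 < C ∧ ∀ s ∈ Set.Icc κ⁻¹ κ, ∀ t ∈ Set.Icc κ⁻¹ κ,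
      |s ^ a - t ^ a - a * t ^ (a - 1) * (s - t)| ≤ C * (s - t) ^ 2 := by
  have hκ0 : 0 < κ := by linarith
  obtain ⟨C, hC, h⟩ := exists_rpow_lipschitz (a - 1) hκ
  refine ⟨(|a| + 1) * C, by positivity, fun s hs t ht => ?_⟩
  have sub : Set.uIcc t s ⊆ Set.Icc κ⁻¹ κ := Set.uIcc_subset_Icc ht hs
  have pos {x : ℝ} (hx : x ∈ Set.uIcc t s) : x ≠ 0 :=
    ((inv_pos.mpr hκ0).trans_le (sub hx).1).ne'
  have key := Convex.norm_image_sub_le_of_norm_hasDerivWithin_le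
    (f := fun x : ℝ => x ^ a - a * t ^ (a - 1) * x)
    (f' := fun x => a * x ^ (a - 1) - a * t ^ (a - 1) * 1) (C := (|a| + 1) * C * |s - t|)
    (fun x hx => ((Real.hasDerivAt_rpow_const (Or.inl (pos hx))).sub
      ((hasDerivAt_id x).const_mul _)).hasDerivWithinAt)
    (fun x hx => ?_) (convex_uIcc t s) Set.left_mem_uIcc Set.right_mem_uIcc
  · rw [Real.norm_eq_abs, Real.norm_eq_abs] at key
    calc _ = |s ^ a - a * t ^ (a - 1) * s - (t ^ a - a * t ^ (a - 1) * t)| := by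
          congr 1; ring
      _ ≤ _ := key
      _ = _ := by rw [← sq_abs (s - t)]; ring
  · have h1 := h x (sub hx) t ht
    have h2 : |x - t| ≤ |s - t| := Set.abs_sub_left_of_mem_uIcc hx
    rw [mul_one, ← mul_sub, norm_mul, Real.norm_eq_abs, Real.norm_eq_abs, mul_assoc]
    exact mul_le_mul (by linarith) (h1.trans (by gcongr)) (abs_nonneg _) (by positivity)

theorem mul_mem_Icc_inv {κ μ s t : ℝ} (hκ : 0 < κ) (hμ : 0 < μ) (hs : s ∈ Set.Icc κ⁻¹ κ)
    (ht : t ∈ Set.Icc μ⁻¹ μ) : s * t ∈ Set.Icc (κ * μ)⁻¹ (κ * μ) := by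
  have hs0 := (inv_pos.mpr hκ).trans_le hs.1
  have ht0 := (inv_pos.mpr hμ).trans_le ht.1
  rw [mul_inv]
  exact ⟨mul_le_mul hs.1 ht.1 (by positivity) hs0.le, mul_le_mul hs.2 ht.2 ht0.le hκ.le⟩

theorem div_mem_Icc_inv {κ μ s t : ℝ} (hκ : 0 < κ) (hμ : 0 < μ) (hs : s ∈ Set.Icc κ⁻¹ κ)
    (ht : t ∈ Set.Icc μ⁻¹ μ) : s / t ∈ Set.Icc (κ * μ)⁻¹ (κ * μ) := by
  have ht0 := (inv_pos.mpr hμ).trans_le ht.1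
  refine mul_mem_Icc_inv hκ hμ hs ⟨inv_anti₀ ht0 ht.2, ?_⟩
  rw [← inv_inv μ]
  exact inv_anti₀ (by positivity) ht.1

theorem Icc_inv_subset {κ μ : ℝ} (hκ : 0 < κ) (h : κ ≤ μ) :
    Set.Icc κ⁻¹ κ ⊆ Set.Icc μ⁻¹ μ :=
  Set.Icc_subset_Icc (inv_anti₀ hκ h) h

/-- Two points near the cone `∑ σᵢ uᵢ ^ α = 0` with nearby directions: the second one lies close
to the tangent hyperplane at the first one. -/
theorem exists_tangent_bound {α : ℝ} (hα : α ≠ 0) {κ : ℝ} (hκ : 1 ≤ κ) :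
    ∃ C : ℝ, 0 < C ∧ ∀ (σ u v : Fin 4 → ℝ) (r : ℝ), (∀ i, |σ i| = 1) →
      (∀ i, u i ∈ Set.Icc κ⁻¹ κ) → (∀ i, v i ∈ Set.Icc κ⁻¹ κ) → 0 ≤ r → r ≤ 1 →
      |∑ i, σ i * u i ^ α| ≤ r ^ 2 → |∑ i, σ i * v i ^ α| ≤ r ^ 2 →
      |v 0 / v 3 - u 0 / u 3| ≤ r → |v 1 / v 3 - u 1 / u 3| ≤ r →
      |∑ i, σ i * u i ^ (α - 1) * v i| ≤ C * r ^ 2 := by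
  have hκ0 : 0 < κ := by linarith
  have hK : 1 ≤ κ * κ * κ := by nlinarith [mul_le_mul hκ hκ zero_le_one hκ0.le]
  have hK2 : 1 ≤ κ * κ := by nlinarith
  obtain ⟨C₀, hC₀, lip⟩ := exists_rpow_lipschitz α hK
  obtain ⟨C₁, hC₁, inv⟩ := exists_rpow_inverse_lipschitz hα hK
  obtain ⟨C₂, hC₂, taylor⟩ := exists_rpow_taylor α hK
  set D := (κ * κ) ^ |α| with hD
  set D' := (κ * κ) ^ |α - 1| with hD'
  have hDpos : 0 < D := by positivity
  have hD'pos : 0 < D' := by positivity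
  have hαpos : 0 < |α| := abs_pos.mpr hα
  set H := κ + C₁ * (1 + D + 2 * C₀ * κ) with hH
  have hHpos : 0 < H := by positivity
  refine ⟨κ * κ + D' * (1 + D + 4 * C₂ * H ^ 2) / |α|, by positivity, ?_⟩
  intro σ u v r hσ hu hv hr hr1 hFu hFv h0 h1
  have upos (i) : 0 < u i := (inv_pos.mpr hκ0).trans_le (hu i).1
  have vpos (i) : 0 < v i := (inv_pos.mpr hκ0).trans_le (hv i).1
  set t := v 3 / u 3 with ht
  have htpos : 0 < t := div_pos (vpos 3) (upos 3)
  have htmem : t ∈ Set.Icc (κ * κ)⁻¹ (κ * κ) := div_mem_Icc_inv hκ0 hκ0 (hv 3) (hu 3)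
  have hp (i) : t * u i ∈ Set.Icc (κ * κ * κ)⁻¹ (κ * κ * κ) :=
    mul_mem_Icc_inv (by positivity) hκ0 htmem (hu i)
  have hv' (i) : v i ∈ Set.Icc (κ * κ * κ)⁻¹ (κ * κ * κ) :=
    Icc_inv_subset hκ0 (by nlinarith) (hv i)
  have hr2 : r ^ 2 ≤ r := by nlinarith
  have htα := rpow_mem_Icc_of_mem_Icc α hK2 htmem
  have htα' := rpow_mem_Icc_of_mem_Icc (α - 1) hK2 htmem
  have htα0 : 0 < t ^ α := by positivity
  have htα0' : 0 < t ^ (α - 1) := by positivity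
  have hdiff (i) (h : |v i / v 3 - u i / u 3| ≤ r) : |v i - t * u i| ≤ κ * r := by
    have : v i - t * u i = v 3 * (v i / v 3 - u i / u 3) := by
      have := (vpos 3).ne'
      have := (upos 3).ne'
      rw [ht]
      field_simp
    rw [this, abs_mul, abs_of_pos (vpos 3)]
    exact mul_le_mul (hv 3).2 h (abs_nonneg _) hκ0.le
  have e3 : v 3 - t * u 3 = 0 := by
    have := (upos 3).ne'
    rw [ht]
    field_simp
    ring
  have hF : ∑ i, σ i * (v i ^ α - (t * u i) ^ α) =
      ∑ i, σ i * v i ^ α - t ^ α * ∑ i, σ i * u i ^ α := by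
    rw [Finset.mul_sum, ← Finset.sum_sub_distrib]
    refine Finset.sum_congr rfl fun i _ => ?_
    rw [Real.mul_rpow htpos.le (upos i).le]
    ring
  have hFb : |∑ i, σ i * (v i ^ α - (t * u i) ^ α)| ≤ (1 + D) * r ^ 2 := by
    rw [hF]
    refine (abs_sub _ _).trans ?_
    rw [abs_mul, abs_of_pos htα0]
    have := mul_le_mul htα.2 hFu (abs_nonneg _) hDpos.le
    linarith
  have hσm (i) (x : ℝ) : |σ i * x| = |x| := by rw [abs_mul, hσ, one_mul]
  have e2 : |v 2 - t * u 2| ≤ C₁ * (1 + D + 2 * C₀ * κ) * r := by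
    have hl0 := (lip _ (hv' 0) _ (hp 0)).trans (mul_le_mul_of_nonneg_left (hdiff 0 h0) hC₀.le)
    have hl1 := (lip _ (hv' 1) _ (hp 1)).trans (mul_le_mul_of_nonneg_left (hdiff 1 h1) hC₀.le)
    have hl3 : v 3 ^ α - (t * u 3) ^ α = 0 := by
      rw [show v 3 = t * u 3 by linarith, sub_self]
    rw [Fin.sum_univ_four, hl3, mul_zero, add_zero] at hFb
    have : |v 2 ^ α - (t * u 2) ^ α| ≤ (1 + D + 2 * C₀ * κ) * r := by
      have tri := abs_sub (σ 0 * (v 0 ^ α - (t * u 0) ^ α) + σ 1 * (v 1 ^ α - (t * u 1) ^ α) +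
        σ 2 * (v 2 ^ α - (t * u 2) ^ α)) (σ 0 * (v 0 ^ α - (t * u 0) ^ α) +
        σ 1 * (v 1 ^ α - (t * u 1) ^ α))
      rw [add_sub_cancel_left, hσm] at tri
      have tri2 := abs_add_le (σ 0 * (v 0 ^ α - (t * u 0) ^ α)) (σ 1 * (v 1 ^ α - (t * u 1) ^ α))
      rw [hσm, hσm] at tri2
      have : (1 + D) * r ^ 2 ≤ (1 + D) * r := by gcongr
      linarith
    calc _ ≤ C₁ * |v 2 ^ α - (t * u 2) ^ α| := inv _ (hv' 2) _ (hp 2)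
      _ ≤ C₁ * ((1 + D + 2 * C₀ * κ) * r) := by gcongr
      _ = _ := by ring
  have he : ∀ i, |v i - t * u i| ≤ H * r := by
    have hle : κ * r ≤ H * r :=
      mul_le_mul_of_nonneg_right (by rw [hH]; exact le_add_of_nonneg_right (by positivity)) hr
    have hle' : C₁ * (1 + D + 2 * C₀ * κ) * r ≤ H * r :=
      mul_le_mul_of_nonneg_right (by rw [hH]; linarith) hr
    intro i
    fin_cases i
    · exact (hdiff 0 h0).trans hle
    · exact (hdiff 1 h1).trans hle
    · exact e2.trans hle'
    · change |v 3 - t * u 3| ≤ _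
      rw [e3, abs_zero]
      positivity
  have hlin : ∑ i, σ i * (v i ^ α - (t * u i) ^ α) - ∑ i, σ i * (v i ^ α - (t * u i) ^ α -
      α * (t * u i) ^ (α - 1) * (v i - t * u i)) =
      α * t ^ (α - 1) * ∑ i, σ i * u i ^ (α - 1) * (v i - t * u i) := by
    rw [Finset.mul_sum, ← Finset.sum_sub_distrib]
    refine Finset.sum_congr rfl fun i _ => ?_
    rw [Real.mul_rpow (z := α - 1) htpos.le (upos i).le]
    ring
  have hrem : |∑ i, σ i * (v i ^ α - (t * u i) ^ α -
      α * (t * u i) ^ (α - 1) * (v i - t * u i))| ≤ 4 * C₂ * H ^ 2 * r ^ 2 := by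
    refine (Finset.abs_sum_le_sum_abs _ _).trans ?_
    calc _ ≤ ∑ _i : Fin 4, C₂ * (H * r) ^ 2 := by
          refine Finset.sum_le_sum fun i _ => ?_
          rw [hσm]
          refine (taylor _ (hv' i) _ (hp i)).trans ?_
          rw [← sq_abs]
          have := he i
          gcongr
      _ = _ := by simp; ring
  have hmain : |∑ i, σ i * u i ^ (α - 1) * (v i - t * u i)| ≤
      D' * (1 + D + 4 * C₂ * H ^ 2) / |α| * r ^ 2 := by
    have h := abs_sub (∑ i, σ i * (v i ^ α - (t * u i) ^ α)) (∑ i, σ i * (v i ^ α - (t * u i) ^ α -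
      α * (t * u i) ^ (α - 1) * (v i - t * u i)))
    rw [hlin, abs_mul, abs_mul, abs_of_pos htα0'] at h
    set Q := |∑ i, σ i * u i ^ (α - 1) * (v i - t * u i)| with hQ
    have hQ0 : 0 ≤ Q := abs_nonneg _
    have h' : |α| * D'⁻¹ * Q ≤ (1 + D + 4 * C₂ * H ^ 2) * r ^ 2 := by
      have : |α| * D'⁻¹ * Q ≤ |α| * t ^ (α - 1) * Q := by
        have := htα'.1
        gcongr
      linarith
    calc Q = D' / |α| * (|α| * D'⁻¹ * Q) := by field_simp
      _ ≤ D' / |α| * ((1 + D + 4 * C₂ * H ^ 2) * r ^ 2) := by gcongr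
      _ = _ := by ring
  have hsplit : ∑ i, σ i * u i ^ (α - 1) * v i =
      t * ∑ i, σ i * u i ^ α + ∑ i, σ i * u i ^ (α - 1) * (v i - t * u i) := by
    rw [Finset.mul_sum, ← Finset.sum_add_distrib]
    refine Finset.sum_congr rfl fun i _ => ?_
    have : u i ^ α = u i ^ (α - 1) * u i := by
      rw [← Real.rpow_add_one (upos i).ne', sub_add_cancel]
    rw [this]
    ring
  rw [hsplit, add_mul]
  refine (abs_add_le _ _).trans (add_le_add ?_ hmain)
  rw [abs_mul, abs_of_pos htpos]
  exact mul_le_mul htmem.2 hFu (abs_nonneg _) (by positivity)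

theorem add_mul_le_one_add_mul {a b x y z : ℝ} (ha : 0 ≤ a) (hb : 0 ≤ b) (hx : 0 ≤ x)
    (hy : 0 ≤ y) (hz : 0 ≤ z) : x + a * y + b * z ≤ (1 + a + b) * (x + y + z) := by
  linarith [mul_nonneg ha hx, mul_nonneg ha hz, mul_nonneg hb hx, mul_nonneg hb hy]

set_option maxHeartbeats 800000 in
/-- Approximate duality: an approximate normal vector at a point near the cone
`∑ σᵢ uᵢ ^ α = 0` lies near the dual cone `∑ σᵢ uᵢ ^ α' = 0`, and determines the direction of the
point. -/
theorem exists_dual_bound {α α' : ℝ} (hαα : (α - 1) * (α' - 1) = 1) {κ : ℝ} (hκ : 1 ≤ κ) :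
    ∃ C : ℝ, 1 ≤ C ∧ ∀ (σ u w ξ : Fin 4 → ℝ) (s δ V W P : ℝ), (∀ i, |σ i| = 1) →
      (∀ i, u i ∈ Set.Icc κ⁻¹ κ) → |∑ i, σ i * u i ^ α| ≤ δ →
      (∀ i, ξ i = s * (σ i * u i ^ (α - 1)) + w i) → (∀ i, |w i| ≤ W) → |∑ i, u i * w i| ≤ V →
      s ≠ 0 → C * W ≤ |s| → 0 < P → P ≤ |ξ 3| → |ξ 3| ≤ 2 * P →
      (∀ i, |ξ i| / P ∈ Set.Icc C⁻¹ C) ∧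
      |∑ i, σ i * (|ξ i| / P) ^ α'| ≤ C * (δ + V / P + W ^ 2 / P ^ 2) ∧
      ∀ i, |u i / u 3 - (|ξ i| / |ξ 3|) ^ (α' - 1)| ≤ C * (W / P) := by
  have hκ0 : 0 < κ := by linarith
  set K := κ ^ |α - 1| with hKdef
  have hK1 : 1 ≤ K := one_le_rpow_abs _ hκ
  have hK0 : 0 < K := by linarith
  have h2K : 1 ≤ 2 * K := by linarith
  have h4K : 1 ≤ 4 * K := by linarith
  have h4K2 : 1 ≤ 2 * K * (2 * K) := by nlinarith
  obtain ⟨C₂, hC₂, taylor⟩ := exists_rpow_taylor α' h2K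
  obtain ⟨C₃, hC₃, lip⟩ := exists_rpow_lipschitz (α' - 1) h4K2
  set D := (4 * K) ^ |α'| with hD
  have hD1 : 1 ≤ D := one_le_rpow_abs _ h4K
  refine ⟨4 * K * (2 * K) + D * (1 + |α'| * (4 * K) + 4 * C₂ * (4 * K) ^ 2) + C₃ * (16 * K ^ 4),
    ?_, ?_⟩
  · have : 0 < C₃ * (16 * K ^ 4) := by positivity
    have : 0 < D * (1 + |α'| * (4 * K) + 4 * C₂ * (4 * K) ^ 2) := by positivity
    nlinarith
  set C := 4 * K * (2 * K) + D * (1 + |α'| * (4 * K) + 4 * C₂ * (4 * K) ^ 2) + C₃ * (16 * K ^ 4)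
    with hC
  intro σ u w ξ s δ V W P hσ hu hF hξ hw hV hs hCs hP hP3 hP3'
  have pos₁ : 0 < D * (1 + |α'| * (4 * K) + 4 * C₂ * (4 * K) ^ 2) := by positivity
  have pos₂ : 0 < C₃ * (16 * K ^ 4) := by positivity
  have pos₃ : 0 < 4 * K * (2 * K) := by positivity
  have hCa : 4 * K * (2 * K) ≤ C := by linarith
  have hCb : D * (1 + |α'| * (4 * K) + 4 * C₂ * (4 * K) ^ 2) ≤ C := by linarith
  have hCc : C₃ * (16 * K ^ 4) ≤ C := by linarith
  have hs0 : 0 < |s| := abs_pos.mpr hs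
  have hW0 : 0 ≤ W := (abs_nonneg _).trans (hw 0)
  have hδ0 : 0 ≤ δ := (abs_nonneg _).trans hF
  have hV0 : 0 ≤ V := (abs_nonneg _).trans hV
  have upos (i) : 0 < u i := (inv_pos.mpr hκ0).trans_le (hu i).1
  have hσ2 (i) : σ i * σ i = 1 := by rw [← abs_mul_abs_self, hσ, one_mul]
  set m : Fin 4 → ℝ := fun i => u i ^ (α - 1) with hm
  set e : Fin 4 → ℝ := fun i => σ i * w i / s with he
  set q : Fin 4 → ℝ := fun i => m i + e i with hq
  have hmK (i) : m i ∈ Set.Icc K⁻¹ K := rpow_mem_Icc_of_mem_Icc _ hκ (hu i)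
  have hmpos (i) : 0 < m i := (inv_pos.mpr hK0).trans_le (hmK i).1
  have heW (i) : |e i| ≤ W / |s| := by
    rw [he]
    simp only [abs_div, abs_mul, hσ, one_mul]
    gcongr
    exact hw i
  have hWs : W / |s| ≤ (2 * K)⁻¹ := by
    rw [div_le_iff₀ hs0, inv_mul_eq_div, le_div_iff₀ (by positivity)]
    refine le_trans ?_ hCs
    rw [mul_comm]
    gcongr
    nlinarith
  have hinv2 : K⁻¹ = 2 * (2 * K)⁻¹ := by field_simp
  have hqK (i) : q i ∈ Set.Icc (2 * K)⁻¹ (2 * K) := by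
    have h1 := abs_le.mp ((heW i).trans hWs)
    have h2 := hmK i
    rw [Set.mem_Icc] at h2 ⊢
    simp only [hq]
    constructor <;> linarith
  have hqpos (i) : 0 < q i := (inv_pos.mpr (by positivity)).trans_le (hqK i).1
  have hmK' (i) : m i ∈ Set.Icc (2 * K)⁻¹ (2 * K) := Icc_inv_subset hK0 (by linarith) (hmK i)
  have hξq (i) : |ξ i| = |s| * q i := by
    have : ξ i = s * σ i * q i := by
      rw [hξ]
      simp only [hq, he, hm]
      field_simp
      linear_combination -w i * hσ2 i
    rw [this, abs_mul, abs_mul, hσ, mul_one, abs_of_pos (hqpos i)]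
  have hmα (i) : m i ^ α' = u i ^ α := by
    rw [hm, ← Real.rpow_mul (upos i).le]
    congr 1
    linarith
  have hmα' (i) : m i ^ (α' - 1) = u i := by
    simp only [hm]
    rw [← Real.rpow_mul (upos i).le, hαα, Real.rpow_one]
  set l := |s| / P with hl
  have hl0 : 0 < l := by positivity
  have hξl (i) : |ξ i| / P = l * q i := by rw [hξq, hl]; ring
  have hlmem : l ∈ Set.Icc (4 * K)⁻¹ (4 * K) := by
    have h1 : 1 ≤ l * q 3 := by rw [← hξl, le_div_iff₀ hP]; linarith
    have h2 : l * q 3 ≤ 2 := by rw [← hξl, div_le_iff₀ hP]; linarith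
    have h3 := hqK 3
    constructor
    · rw [inv_le_iff_one_le_mul₀ (by positivity)]
      have := mul_le_mul_of_nonneg_left h3.2 hl0.le
      nlinarith
    · have := mul_le_mul_of_nonneg_left h3.1 hl0.le
      have h4 : l * (2 * K)⁻¹ ≤ 2 := this.trans h2
      rw [← div_eq_mul_inv, div_le_iff₀ (by positivity)] at h4
      linarith
  have hls : 1 / |s| ≤ 4 * K / P := by
    have := hlmem.1
    rw [hl, le_div_iff₀ hP, inv_mul_le_iff₀ (by positivity)] at this
    rw [div_le_div_iff₀ hs0 hP]
    linarith
  have hWP : W / |s| ≤ 4 * K * (W / P) := by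
    calc W / |s| = W * (1 / |s|) := by ring
      _ ≤ W * (4 * K / P) := by gcongr
      _ = _ := by ring
  refine ⟨fun i => ?_, ?_, fun i => ?_⟩
  · rw [hξl]
    exact Icc_inv_subset (by positivity) hCa (mul_mem_Icc_inv (by positivity) (by positivity)
      hlmem (hqK i))
  · have hsum : ∑ i, σ i * (|ξ i| / P) ^ α' = l ^ α' * (∑ i, σ i * u i ^ α +
        α' / s * ∑ i, u i * w i +
        ∑ i, σ i * (q i ^ α' - m i ^ α' - α' * m i ^ (α' - 1) * (q i - m i))) := by
      rw [Finset.mul_sum, ← Finset.sum_add_distrib, ← Finset.sum_add_distrib, Finset.mul_sum]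
      refine Finset.sum_congr rfl fun i _ => ?_
      rw [hξl, Real.mul_rpow hl0.le (hqpos i).le, hmα, hmα']
      have : q i - m i = σ i * w i / s := by simp only [hq, he]; ring
      rw [this]
      field_simp
      linear_combination (α' * u i * w i) * hσ2 i
    have hrem : |∑ i, σ i * (q i ^ α' - m i ^ α' - α' * m i ^ (α' - 1) * (q i - m i))| ≤
        4 * C₂ * (W / |s|) ^ 2 := by
      refine (Finset.abs_sum_le_sum_abs _ _).trans ?_
      calc _ ≤ ∑ _i : Fin 4, C₂ * (W / |s|) ^ 2 := by
            refine Finset.sum_le_sum fun i _ => ?_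
            rw [abs_mul, hσ, one_mul]
            refine (taylor _ (hqK i) _ (hmK' i)).trans ?_
            rw [← sq_abs]
            have : |q i - m i| ≤ W / |s| := by
              simp only [hq, add_sub_cancel_left]; exact heW i
            gcongr
        _ = _ := by simp; ring
    have hmid : |α' / s * ∑ i, u i * w i| ≤ |α'| * (4 * K) * (V / P) := by
      rw [abs_mul, abs_div]
      calc |α'| / |s| * |∑ i, u i * w i| ≤ |α'| / |s| * V := by gcongr
        _ = |α'| * V * (1 / |s|) := by ring
        _ ≤ |α'| * V * (4 * K / P) := by gcongr
        _ = _ := by ring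
    have hlα := rpow_mem_Icc_of_mem_Icc α' h4K hlmem
    rw [hsum, abs_mul, abs_of_pos (by positivity : 0 < l ^ α')]
    have hVP : 0 ≤ V / P := by positivity
    have hWP2 : 0 ≤ W ^ 2 / P ^ 2 := by positivity
    calc _ ≤ D * (δ + |α'| * (4 * K) * (V / P) + 4 * C₂ * (4 * K * (W / P)) ^ 2) := by
          refine mul_le_mul hlα.2 ?_ (abs_nonneg _) (by positivity)
          refine (abs_add_le _ _).trans (add_le_add ((abs_add_le _ _).trans
            (add_le_add hF hmid)) (hrem.trans ?_))
          gcongr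
      _ ≤ D * ((1 + |α'| * (4 * K) + 4 * C₂ * (4 * K) ^ 2) * (δ + V / P + W ^ 2 / P ^ 2)) := by
          have : (4 * C₂ * (4 * K * (W / P)) ^ 2) = 4 * C₂ * (4 * K) ^ 2 * (W ^ 2 / P ^ 2) := by
            rw [mul_pow, div_pow]; ring
          rw [this]
          exact mul_le_mul_of_nonneg_left (add_mul_le_one_add_mul (by positivity) (by positivity)
            hδ0 hVP hWP2) (by positivity)
      _ ≤ C * (δ + V / P + W ^ 2 / P ^ 2) := by
          rw [← mul_assoc]
          gcongr
  · have h1 : u i / u 3 = (m i / m 3) ^ (α' - 1) := by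
      rw [Real.div_rpow (hmpos i).le (hmpos 3).le, hmα', hmα']
    have h2 : |ξ i| / |ξ 3| = q i / q 3 := by
      rw [hξq, hξq, mul_div_mul_left _ _ hs0.ne']
    rw [h1, h2]
    refine (lip _ (div_mem_Icc_inv (by positivity) (by positivity) (hmK' i) (hmK' 3)) _
      (div_mem_Icc_inv (by positivity) (by positivity) (hqK i) (hqK 3))).trans ?_
    have h3 : m i / m 3 - q i / q 3 = (m i * e 3 - e i * m 3) * (1 / m 3) * (1 / q 3) := by
      have := (hmpos 3).ne'
      have := (hqpos 3).ne'
      field_simp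
      simp only [hq]
      ring
    have h4 : |m i * e 3 - e i * m 3| ≤ 2 * K * (W / |s|) := by
      refine (abs_sub _ _).trans ?_
      rw [abs_mul, abs_mul, abs_of_pos (hmpos i), abs_of_pos (hmpos 3)]
      have := mul_le_mul (hmK i).2 (heW 3) (abs_nonneg _) hK0.le
      have := mul_le_mul (heW i) (hmK 3).2 (hmpos 3).le (by positivity)
      linarith
    have h5 : 1 / m 3 ≤ K := by
      rw [one_div]; exact inv_le_of_inv_le₀ hK0 (hmK 3).1
    have h6 : 1 / q 3 ≤ 2 * K := by
      rw [one_div]; exact inv_le_of_inv_le₀ (by positivity) (hqK 3).1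
    have h7 := hmpos 3
    have h8 := hqpos 3
    rw [h3, abs_mul, abs_mul, abs_of_pos (one_div_pos.mpr h7), abs_of_pos (one_div_pos.mpr h8)]
    calc C₃ * (|m i * e 3 - e i * m 3| * (1 / m 3) * (1 / q 3))
        ≤ C₃ * (2 * K * (4 * K * (W / P)) * K * (2 * K)) := by
          have := h4.trans (mul_le_mul_of_nonneg_left hWP (by positivity))
          gcongr
      _ = C₃ * (16 * K ^ 4) * (W / P) := by ring
      _ ≤ C * (W / P) := by gcongr

theorem card_int_le_of_abs_sub_le {S : Finset ℤ} {c D : ℝ} (hD : 0 ≤ D)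
    (h : ∀ n ∈ S, |(n : ℝ) - c| ≤ D) : (S.card : ℝ) ≤ 2 * D + 1 := by
  have hsub : S ⊆ Finset.Icc ⌈c - D⌉ ⌊c + D⌋ := fun n hn => by
    have := abs_le.mp (h n hn)
    rw [Finset.mem_Icc, Int.ceil_le, Int.le_floor]
    constructor <;> linarith
  have hcard : (S.card : ℝ) ≤ ((⌊c + D⌋ + 1 - ⌈c - D⌉).toNat : ℝ) := by
    rw [← Int.card_Icc]
    exact_mod_cast Finset.card_le_card hsub
  refine hcard.trans ?_
  rcases le_total 0 (⌊c + D⌋ + 1 - ⌈c - D⌉) with h0 | h0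
  · rw [← Int.cast_natCast, Int.toNat_of_nonneg h0]
    push_cast
    linarith [Int.floor_le (c + D), Int.le_ceil (c - D)]
  · rw [Int.toNat_of_nonpos h0]
    push_cast
    linarith

theorem card_int_prod_le_of_abs_sub_le {S : Finset (ℤ × ℤ)} {c d D : ℝ} (hD : 0 ≤ D)
    (hc : ∀ n ∈ S, |(n.1 : ℝ) - c| ≤ D) (hd : ∀ n ∈ S, |(n.2 : ℝ) - d| ≤ D) :
    (S.card : ℝ) ≤ (2 * D + 1) ^ 2 := by
  have h1 : ((S.image Prod.fst).card : ℝ) ≤ 2 * D + 1 :=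
    card_int_le_of_abs_sub_le hD (by simpa using fun a b hab => hc (a, b) hab)
  have h2 : ((S.image Prod.snd).card : ℝ) ≤ 2 * D + 1 :=
    card_int_le_of_abs_sub_le hD (by simpa using fun b a hab => hd (a, b) hab)
  calc (S.card : ℝ) ≤ ((S.image Prod.fst ×ˢ S.image Prod.snd).card : ℝ) := by
        exact_mod_cast Finset.card_le_card Finset.subset_product
    _ = (S.image Prod.fst).card * (S.image Prod.snd).card := by
        rw [Finset.card_product]; push_cast; rfl
    _ ≤ (2 * D + 1) * (2 * D + 1) := by gcongr
    _ = _ := by ring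

theorem card_pi_int_le_of_abs_le {S : Finset (Fin 4 → ℤ)} {D : ℝ} (hD : 0 ≤ D)
    (h : ∀ x ∈ S, ∀ i, |(x i : ℝ)| ≤ D) : (S.card : ℝ) ≤ (2 * D + 1) ^ 4 := by
  have hi (i : Fin 4) : ((S.image fun x => x i).card : ℝ) ≤ 2 * D + 1 :=
    card_int_le_of_abs_sub_le (c := 0) hD (by simpa using fun x hx => h x hx i)
  calc (S.card : ℝ) ≤ ((Fintype.piFinset fun i => S.image fun x => x i).card : ℝ) := by
        refine Nat.cast_le.mpr (Finset.card_le_card fun x hx => ?_)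
        exact Fintype.mem_piFinset.mpr fun i => Finset.mem_image_of_mem _ hx
    _ = ∏ i : Fin 4, ((S.image fun x => x i).card : ℝ) := by
        rw [Fintype.card_piFinset]; push_cast; rfl
    _ ≤ ∏ _i : Fin 4, (2 * D + 1) := by gcongr with i; exact hi i
    _ = _ := by simp

theorem finite_pi_int_of_abs_le {N : Set (Fin 4 → ℤ)} (D : ℝ)
    (h : ∀ x ∈ N, ∀ i, |(x i : ℝ)| ≤ D) : N.Finite := by
  refine (Set.finite_Icc (fun _ => -⌈D⌉ : Fin 4 → ℤ) fun _ => ⌈D⌉).subset fun x hx => ?_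
  have hxi (i) : |x i| ≤ ⌈D⌉ := by
    have := (h x hx i).trans (Int.le_ceil D)
    exact_mod_cast this
  exact ⟨fun i => (abs_le.mp (hxi i)).1, fun i => (abs_le.mp (hxi i)).2⟩

theorem card_le_of_abs_mem {S : Finset (Fin 4 → ℤ)} {N : Set (Fin 4 → ℤ)} (hN : N.Finite)
    (h : ∀ ξ ∈ S, (fun i => |ξ i|) ∈ N) : S.card ≤ 16 * N.ncard := by
  have h1 : S.card ≤ 16 * (S.image fun ξ i => |ξ i|).card := by
    refine Finset.card_le_mul_card_image S 16 fun a _ => ?_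
    calc _ ≤ (Fintype.piFinset fun i => ({a i, -a i} : Finset ℤ)).card := by
          refine Finset.card_le_card fun ξ hξ => Fintype.mem_piFinset.mpr fun i => ?_
          have := congrFun (Finset.mem_filter.mp hξ).2 i
          rw [Finset.mem_insert, Finset.mem_singleton]
          have h2 : |ξ i| = |a i| := by rw [← this, abs_abs]
          exact abs_eq_abs.mp h2
      _ = ∏ i : Fin 4, ({a i, -a i} : Finset ℤ).card := Fintype.card_piFinset _
      _ ≤ ∏ _i : Fin 4, 2 := Finset.prod_le_prod' fun i _ => Finset.card_le_two
      _ = 16 := by simp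
  refine h1.trans (Nat.mul_le_mul_left _ ?_)
  rw [← Set.ncard_coe_finset]
  refine Set.ncard_le_ncard (fun a ha => ?_) hN
  obtain ⟨ξ, hξ, rfl⟩ := Finset.mem_image.mp (Finset.mem_coe.mp ha)
  exact h ξ hξ

theorem exists_sum_two_pow_rpow_le {γ : ℝ} (hγ : 0 < γ) :
    ∃ C : ℝ, 0 < C ∧ ∀ (N : ℝ) (J : Finset ℕ), 0 < N → (∀ j ∈ J, (2 : ℝ) ^ j ≤ N) →
      ∑ j ∈ J, ((2 : ℝ) ^ j) ^ γ ≤ C * N ^ γ := by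
  set r : ℝ := 2 ^ γ with hr
  have hr1 : 1 < r := Real.one_lt_rpow one_lt_two hγ
  have hr0 : 0 < r - 1 := by linarith
  refine ⟨r / (r - 1), by positivity, fun N J hN hJ => ?_⟩
  have hpow (j : ℕ) : ((2 : ℝ) ^ j) ^ γ = r ^ j := by
    rw [hr, ← Real.rpow_natCast, ← Real.rpow_natCast, ← Real.rpow_mul zero_le_two,
      ← Real.rpow_mul zero_le_two, mul_comm]
  simp only [hpow]
  rcases J.eq_empty_or_nonempty with rfl | hne
  · rw [Finset.sum_empty]
    positivity
  set m := J.max' hne with hm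
  have hmN : r ^ m ≤ N ^ γ := by
    rw [← hpow]
    exact Real.rpow_le_rpow (by positivity) (hJ m (J.max'_mem hne)) hγ.le
  calc ∑ j ∈ J, r ^ j ≤ ∑ j ∈ Finset.range (m + 1), r ^ j := by
        refine Finset.sum_le_sum_of_subset_of_nonneg (fun j hj => ?_) fun _ _ _ => by positivity
        exact Finset.mem_range.mpr (Nat.lt_succ_of_le (J.le_max' j hj))
    _ = (r ^ (m + 1) - 1) / (r - 1) := geom_sum_eq hr1.ne' _
    _ ≤ r / (r - 1) * r ^ m := by
        rw [pow_succ, div_mul_eq_mul_div]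
        gcongr
        linarith
    _ ≤ _ := by gcongr

/-- Integer points of a dilated box lying within `δ / L` of the cone `∑ σᵢ uᵢ ^ α = 0` after
rescaling by `L`. -/
def nearSet (σ : Fin 4 → ℝ) (α κ L δ : ℝ) : Set (Fin 4 → ℤ) :=
  {x | (∀ i, (x i : ℝ) / L ∈ Set.Icc κ⁻¹ κ) ∧ |∑ i, σ i * ((x i : ℝ) / L) ^ α| ≤ δ / L}

theorem abs_le_of_mem_nearSet {σ : Fin 4 → ℝ} {α κ L δ : ℝ} {x : Fin 4 → ℤ} (hκ : 1 ≤ κ)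
    (hL : 0 < L) (hx : x ∈ nearSet σ α κ L δ) (i : Fin 4) : |(x i : ℝ)| ≤ κ * L := by
  have h0 : 0 < (x i : ℝ) / L := (inv_pos.mpr (by linarith)).trans_le (hx.1 i).1
  have h1 := (hx.1 i).2
  rw [div_le_iff₀ hL] at h1
  rwa [abs_of_pos]
  exact (div_pos_iff_of_pos_right hL).mp h0

theorem nearSet_finite (σ : Fin 4 → ℝ) (α : ℝ) {κ L : ℝ} (δ : ℝ) (hκ : 1 ≤ κ) (hL : 0 < L) :
    (nearSet σ α κ L δ).Finite :=
  finite_pi_int_of_abs_le _ fun _ hx => abs_le_of_mem_nearSet hκ hL hx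

theorem nearSet_mono (σ : Fin 4 → ℝ) (α κ : ℝ) {L δ δ' : ℝ} (hL : 0 < L) (h : δ ≤ δ') :
    nearSet σ α κ L δ ⊆ nearSet σ α κ L δ' :=
  fun _ hx => ⟨hx.1, hx.2.trans (by gcongr)⟩

theorem ncard_nearSet_le (σ : Fin 4 → ℝ) (α : ℝ) {κ L : ℝ} (δ : ℝ) (hκ : 1 ≤ κ) (hL : 1 ≤ L) :
    ((nearSet σ α κ L δ).ncard : ℝ) ≤ 81 * κ ^ 4 * L ^ 4 := by
  have hL0 : 0 < L := by linarith
  have hfin := nearSet_finite σ α δ hκ hL0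
  rw [Set.ncard_eq_toFinset_card _ hfin]
  refine (card_pi_int_le_of_abs_le (D := κ * L) (by positivity) fun x hx =>
    abs_le_of_mem_nearSet hκ hL0 (hfin.mem_toFinset.mp hx)).trans ?_
  have : 2 * (κ * L) + 1 ≤ 3 * (κ * L) := by nlinarith
  calc _ ≤ (3 * (κ * L)) ^ 4 := by gcongr
    _ = _ := by ring

/-- The number of integer points near the cone is at most a constant times the expected count
`δ L ^ 3` plus `L ^ β`. -/
def HasBound (σ : Fin 4 → ℝ) (α β : ℝ) : Prop :=
  ∀ κ : ℝ, 1 ≤ κ → ∃ C : ℝ, 0 < C ∧ ∀ L δ : ℝ, 1 ≤ L → 0 < δ →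
    ((nearSet σ α κ L δ).ncard : ℝ) ≤ C * (δ * L ^ 3 + L ^ β)

theorem hasBound_four (σ : Fin 4 → ℝ) (α : ℝ) : HasBound σ α 4 := by
  intro κ hκ
  refine ⟨81 * κ ^ 4, by positivity, fun L δ hL hδ => ?_⟩
  refine (ncard_nearSet_le σ α δ hκ hL).trans ?_
  have : L ^ (4 : ℝ) = L ^ 4 := by exact_mod_cast Real.rpow_natCast L 4
  rw [this]
  gcongr
  exact le_add_of_nonneg_left (by positivity)

/-- `ξ` is an approximate integer multiple of the normal vector of the cone at `x`. -/
def IsDualPoint (σ : Fin 4 → ℝ) (α κ L M ρ : ℝ) (x ξ : Fin 4 → ℤ) : Prop :=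
  ∃ (s : ℝ) (w : Fin 4 → ℝ), |s| ≤ M ∧ (∀ i, |w i| ≤ 3 * κ ^ 2 * (M * ρ)) ∧
    |∑ i, (x i : ℝ) / L * w i| ≤ κ * (M * ρ ^ 2) ∧
    ∀ i, (ξ i : ℝ) = s * (σ i * ((x i : ℝ) / L) ^ (α - 1)) + w i

theorem exists_cell_bound {α : ℝ} (hα : α ≠ 0) {κ : ℝ} (hκ : 1 ≤ κ) :
    ∃ C : ℝ, 0 < C ∧ ∀ (σ : Fin 4 → ℝ) (L M ρ : ℝ) (x : Fin 4 → ℤ) (S T : Finset (Fin 4 → ℤ)),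
      (∀ i, |σ i| = 1) → 0 < L → 0 < M → 0 < ρ → ρ ≤ 1 → L * M * ρ ^ 2 = 1 →
      x ∈ nearSet σ α κ L (1 / M) → (∀ y ∈ S, y ∈ nearSet σ α κ L (1 / M)) →
      (∀ y ∈ S, |(y 0 : ℝ) / y 3 - x 0 / x 3| ≤ ρ) →
      (∀ y ∈ S, |(y 1 : ℝ) / y 3 - x 1 / x 3| ≤ ρ) →
      (∀ ξ, IsDualPoint σ α κ L M ρ x ξ → ξ ∈ T) →
      (S.card : ℝ) ≤ C * (L ^ 2 / M ^ 2) * T.card := by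
  obtain ⟨C₁, hC₁, htan⟩ := exists_tangent_bound hα hκ
  have hκ0 : 0 < κ := by linarith
  set K := κ ^ |α - 1| with hK
  have hK0 : 0 < K := by positivity
  refine ⟨K * (4 * (16 * κ * (16 * κ) * (16 * (C₁ + 1)) * (16 * κ))), by positivity, ?_⟩
  intro σ L M ρ x S T hσ hL hM hρ hρ1 hLM hx hS hS0 hS1 hT
  set u : Fin 4 → ℝ := fun i => (x i : ℝ) / L with hu
  have upos (i) : 0 < u i := (inv_pos.mpr hκ0).trans_le (hx.1 i).1
  set n : Fin 4 → ℝ := fun i => σ i * u i ^ (α - 1) with hn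
  set θ : Fin 4 → ℝ := fun i => u i / u 3 with hθ
  have hθx (i) : θ i = (x i : ℝ) / x 3 := by
    simp only [hθ, hu]
    rw [div_div_div_cancel_right₀ hL.ne']
  set A : Matrix (Fin 4) (Fin 4) ℝ :=
    !![1, 0, 0, -θ 0; 0, 1, 0, -θ 1; n 0, n 1, n 2, n 3; 0, 0, 0, 1] with hA
  have hdet : A.det = n 2 := by
    rw [hA]
    simp [Matrix.det_succ_row_zero, Fin.sum_univ_succ, Fin.succAbove]
  have hn2 : K⁻¹ ≤ |A.det| := by
    rw [hdet]
    simp only [hn]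
    rw [abs_mul, hσ, one_mul]
    exact (rpow_mem_Icc_of_mem_Icc (α - 1) hκ (hx.1 2)).1.trans (le_abs_self _)
  have hδ : 1 / M / L = ρ ^ 2 := by
    field_simp
    linarith
  set b : Fin 4 → ℝ := ![κ * (L * ρ), κ * (L * ρ), (C₁ + 1) * (L * ρ ^ 2), κ * L] with hb
  have key := card_le_of_dual_card A b ?_ S T ?_ ?_
  · have hprod : ∏ i, (4 * (Fintype.card (Fin 4) : ℝ) * b i) =
        16 * κ * (16 * κ) * (16 * (C₁ + 1)) * (16 * κ) * (L ^ 2 / M ^ 2) := by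
      have : L ^ 2 / M ^ 2 = (L * ρ) * (L * ρ) * (L * ρ ^ 2) * L := by
        field_simp
        linear_combination (-1 - L * M * ρ ^ 2) * hLM
      rw [this, Fin.prod_univ_four, Fintype.card_fin]
      simp [hb]
      ring
    rw [hprod] at key
    calc (S.card : ℝ) = K * (S.card * K⁻¹) := by field_simp
      _ ≤ K * (S.card * |A.det|) := by gcongr
      _ ≤ _ := by
        refine (mul_le_mul_of_nonneg_left key hK0.le).trans (le_of_eq ?_)
        ring
  · intro i
    fin_cases i <;> simp [hb] <;> positivity
  · intro y hy i
    set v : Fin 4 → ℝ := fun i => (y i : ℝ) / L with hv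
    have hyv (i) : (y i : ℝ) = L * v i := by simp only [hv]; field_simp
    have hyS := hS y hy
    have vpos (i) : 0 < v i := (inv_pos.mpr hκ0).trans_le (hyS.1 i).1
    have hvθ (i) (h : |(y i : ℝ) / y 3 - x i / x 3| ≤ ρ) :
        |v i / v 3 - u i / u 3| ≤ ρ := by
      have h1 : v i / v 3 = (y i : ℝ) / y 3 := by
        simp only [hv]
        rw [div_div_div_cancel_right₀ hL.ne']
      rw [h1, show u i / u 3 = (x i : ℝ) / x 3 from hθx i]
      exact h
    have hrow (i) (h : |(y i : ℝ) / y 3 - x i / x 3| ≤ ρ) :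
        |(y i : ℝ) - θ i * y 3| ≤ κ * (L * ρ) := by
      have h1 : (y i : ℝ) - θ i * y 3 = L * v 3 * (v i / v 3 - u i / u 3) := by
        have := (vpos 3).ne'
        rw [hyv, hyv]
        simp only [hθ]
        field_simp
      rw [h1, abs_mul, abs_of_pos (mul_pos hL (vpos 3))]
      calc L * v 3 * |v i / v 3 - u i / u 3| ≤ L * κ * ρ :=
            mul_le_mul (mul_le_mul_of_nonneg_left (hyS.1 3).2 hL.le) (hvθ i h) (abs_nonneg _)
              (by positivity)
        _ = _ := by ring
    fin_cases i
    · simpa [hA, hb, Fin.sum_univ_four, ← sub_eq_add_neg] using hrow 0 (hS0 y hy)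
    · simpa [hA, hb, Fin.sum_univ_four, ← sub_eq_add_neg] using hrow 1 (hS1 y hy)
    · have h1 := htan σ u v ρ hσ hx.1 hyS.1 hρ.le hρ1 (hδ ▸ hx.2) (hδ ▸ hyS.2)
        (hvθ 0 (hS0 y hy)) (hvθ 1 (hS1 y hy))
      have h2 : ∑ j, A 2 j * (y j : ℝ) = L * ∑ i, σ i * u i ^ (α - 1) * v i := by
        simp [hA, Fin.sum_univ_four, hyv, hn]
        ring
      change |∑ j, A 2 j * (y j : ℝ)| ≤ (C₁ + 1) * (L * ρ ^ 2)
      rw [h2, abs_mul, abs_of_pos hL]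
      nlinarith [mul_le_mul_of_nonneg_left h1 hL.le, mul_pos hL (pow_pos hρ 2)]
    · simpa [hA, hb, Fin.sum_univ_four] using abs_le_of_mem_nearSet hκ hL hyS 3
  · intro ξ s hs hξ
    have h16 {i} {t : ℝ} (hbi : 0 < b i) (h : 1 ≤ 16 * b i * t) : |s i| ≤ t := by
      refine (hs i).trans ?_
      rw [Fintype.card_fin, div_le_iff₀ (by positivity)]
      push_cast
      linarith
    have hMρ : 0 < M * ρ := by positivity
    have hκ2 : 1 ≤ κ ^ 2 := one_le_pow₀ hκ
    have s0 : |s 0| ≤ M * ρ := by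
      refine h16 (by simp only [hb, Matrix.cons_val]; positivity) ?_
      simp only [hb, Matrix.cons_val]
      linarith [congrArg (κ * ·) hLM]
    have s1 : |s 1| ≤ M * ρ := by
      refine h16 (by simp only [hb, Matrix.cons_val]; positivity) ?_
      simp only [hb, Matrix.cons_val]
      linarith [congrArg (κ * ·) hLM]
    have s2 : |s 2| ≤ M := by
      refine h16 (by simp only [hb, Matrix.cons_val]; positivity) ?_
      simp only [hb, Matrix.cons_val]
      linarith [congrArg (C₁ * ·) hLM]
    have s3 : |s 3| ≤ M * ρ ^ 2 := by
      refine h16 (by simp only [hb, Matrix.cons_val]; positivity) ?_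
      simp only [hb, Matrix.cons_val]
      linarith [congrArg (κ * ·) hLM]
    have hρ2 : M * ρ ^ 2 ≤ M * ρ := by
      rw [sq]
      nlinarith
    have hθκ (i) : |θ i| ≤ κ ^ 2 := by
      rw [abs_of_pos (div_pos (upos i) (upos 3)), sq]
      exact (div_mem_Icc_inv hκ0 hκ0 (hx.1 i) (hx.1 3)).2
    have hMκ : M * ρ ≤ κ ^ 2 * (M * ρ) := le_mul_of_one_le_left hMρ.le hκ2
    refine hT ξ ⟨s 2, ![s 0, s 1, 0, s 3 - θ 0 * s 0 - θ 1 * s 1], s2, fun i => ?_, ?_,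
      fun i => ?_⟩
    · fin_cases i
      · change |s 0| ≤ _
        linarith
      · change |s 1| ≤ _
        linarith
      · change |(0 : ℝ)| ≤ _
        rw [abs_zero]
        positivity
      · change |s 3 - θ 0 * s 0 - θ 1 * s 1| ≤ _
        have t0 : |θ 0 * s 0| ≤ κ ^ 2 * (M * ρ) := by
          rw [abs_mul]
          exact mul_le_mul (hθκ 0) s0 (abs_nonneg _) (by positivity)
        have t1 : |θ 1 * s 1| ≤ κ ^ 2 * (M * ρ) := by
          rw [abs_mul]
          exact mul_le_mul (hθκ 1) s1 (abs_nonneg _) (by positivity)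
        linarith [abs_sub (s 3 - θ 0 * s 0) (θ 1 * s 1), abs_sub (s 3) (θ 0 * s 0)]
    · have h1 : ∑ i, (x i : ℝ) / L * ![s 0, s 1, 0, s 3 - θ 0 * s 0 - θ 1 * s 1] i =
          u 3 * s 3 := by
        have := (upos 3).ne'
        change ∑ i, u i * ![s 0, s 1, 0, s 3 - θ 0 * s 0 - θ 1 * s 1] i = u 3 * s 3
        rw [Fin.sum_univ_four]
        simp only [hθ, Matrix.cons_val]
        field_simp
        ring
      rw [h1, abs_mul, abs_of_pos (upos 3)]
      exact mul_le_mul (hx.1 3).2 s3 (abs_nonneg _) hκ0.le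
    · rw [hξ i, Fin.sum_univ_four]
      change _ = s 2 * n i + _
      fin_cases i <;> simp [hA] <;> ring

theorem exists_isDualPoint_cases {α α' : ℝ} (hαα : (α - 1) * (α' - 1) = 1) {κ : ℝ} (hκ : 1 ≤ κ) :
    ∃ C : ℝ, 1 ≤ C ∧ ∀ (σ : Fin 4 → ℝ) (L M ρ : ℝ) (x ξ : Fin 4 → ℤ), (∀ i, |σ i| = 1) →
      0 < L → 0 < M → M ≤ L → 0 < ρ → ρ ≤ 1 → L * M * ρ ^ 2 = 1 →
      x ∈ nearSet σ α κ L (1 / M) → IsDualPoint σ α κ L M ρ x ξ →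
      (∀ i, |(ξ i : ℝ)| ≤ C) ∨
      ((2 : ℝ) ^ Nat.log 2 (ξ 3).natAbs ≤ C * M ∧
        (fun i => |ξ i|) ∈ nearSet σ α' C (2 ^ Nat.log 2 (ξ 3).natAbs)
          (C * (M * ρ) ^ 2 / 2 ^ Nat.log 2 (ξ 3).natAbs) ∧
        ∀ i, |(x i : ℝ) / x 3 - (|(ξ i : ℝ)| / |(ξ 3 : ℝ)|) ^ (α' - 1)| ≤
          C * (M * ρ / 2 ^ Nat.log 2 (ξ 3).natAbs)) := by
  obtain ⟨C₀, hC₀, hdual⟩ := exists_dual_bound hαα hκ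
  have hκ0 : 0 < κ := by linarith
  set K := κ ^ |α - 1| with hKdef
  have hK1 : 1 ≤ K := one_le_rpow_abs _ hκ
  have hK0 : 0 < K := by linarith
  set S := C₀ * (3 * κ ^ 2) + K * (3 * κ ^ 2 + 1) with hS
  set G := K + 3 * κ ^ 2 with hG
  set C := (S * K + 3 * κ ^ 2) + G + C₀ * (G ^ 2 + κ * G + 9 * κ ^ 4) + C₀ * (3 * κ ^ 2) + C₀
    with hC
  have hS0 : 0 < S := by positivity
  have hG0 : 0 < G := by positivity
  have p1 : 0 < S * K + 3 * κ ^ 2 := by positivity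
  have p2 : 0 < C₀ * (G ^ 2 + κ * G + 9 * κ ^ 4) := by positivity
  have p3 : 0 < C₀ * (3 * κ ^ 2) := by positivity
  refine ⟨C, by linarith, ?_⟩
  intro σ L M ρ x ξ hσ hL hM hML hρ hρ1 hLM hx ⟨s, w, hsM, hw, hV, hξ⟩
  set u : Fin 4 → ℝ := fun i => (x i : ℝ) / L with hu
  have hMρ : 0 < M * ρ := by positivity
  have hMρ1 : M * ρ ≤ 1 := by
    refine (sq_le_one_iff₀ hMρ.le).mp ?_
    rw [← hLM]
    nlinarith [mul_le_mul_of_nonneg_left hML (by positivity : 0 ≤ M * ρ ^ 2)]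
  have hMρM : M * ρ ≤ M := mul_le_of_le_one_right hM.le hρ1
  have hm (i) : u i ^ (α - 1) ∈ Set.Icc K⁻¹ K := rpow_mem_Icc_of_mem_Icc _ hκ (hx.1 i)
  have hn (i) : |σ i * u i ^ (α - 1)| = u i ^ (α - 1) := by
    rw [abs_mul, hσ, one_mul, abs_of_pos ((inv_pos.mpr hK0).trans_le (hm i).1)]
  have hw1 (i) : |w i| ≤ 3 * κ ^ 2 := (hw i).trans (mul_le_of_le_one_right (by positivity) hMρ1)
  have hξs (i) : |(ξ i : ℝ)| ≤ |s| * K + |w i| := by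
    rw [hξ]
    refine (abs_add_le _ _).trans ?_
    rw [abs_mul, hn]
    gcongr
    exact (hm i).2
  rcases lt_or_ge |s| S with hsS | hsS
  · left
    intro i
    have := mul_le_mul_of_nonneg_right hsS.le hK0.le
    linarith [hξs i, hw1 i]
  right
  have hs0 : s ≠ 0 := abs_pos.mp (hS0.trans_le hsS)
  have hξ3 : (ξ 3).natAbs ≠ 0 := by
    intro h0
    have h1 : (ξ 3 : ℝ) = 0 := by exact_mod_cast Int.natAbs_eq_zero.mp h0
    have h2 : s * (σ 3 * u 3 ^ (α - 1)) = -w 3 := by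
      have h3 := hξ 3
      rw [h1] at h3
      linarith
    have h4 : |s| * u 3 ^ (α - 1) = |w 3| := by rw [← hn 3, ← abs_mul, h2, abs_neg]
    have h5 : K * (3 * κ ^ 2 + 1) * K⁻¹ ≤ |s| * u 3 ^ (α - 1) :=
      mul_le_mul (by linarith) (hm 3).1 (by positivity) (abs_nonneg _)
    have h6 : K * (3 * κ ^ 2 + 1) * K⁻¹ = 3 * κ ^ 2 + 1 := by field_simp
    linarith [hw1 3]
  have hcast : (((ξ 3).natAbs : ℕ) : ℝ) = |(ξ 3 : ℝ)| := by
    rw [Nat.cast_natAbs, Int.cast_abs]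
  set P : ℝ := 2 ^ Nat.log 2 (ξ 3).natAbs with hP
  have hP0 : 0 < P := by positivity
  have hP1 : P ≤ |(ξ 3 : ℝ)| := by
    rw [← hcast, hP]
    exact_mod_cast Nat.pow_log_le_self 2 hξ3
  have hP2 : |(ξ 3 : ℝ)| ≤ 2 * P := by
    rw [← hcast, hP, ← pow_succ']
    exact_mod_cast (Nat.lt_pow_succ_log_self one_lt_two _).le
  have hPM : P ≤ G * M := by
    have h1 := mul_le_mul_of_nonneg_right hsM hK0.le
    have h2 := mul_le_mul_of_nonneg_left hMρM (by positivity : 0 ≤ 3 * κ ^ 2)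
    linarith [hξs 3, hw 3]
  have hδ : 1 / M / L = ρ ^ 2 := by
    field_simp
    linarith
  have hsW : C₀ * (3 * κ ^ 2 * (M * ρ)) ≤ |s| := by
    have := mul_le_mul_of_nonneg_left hMρ1 (by positivity : 0 ≤ C₀ * (3 * κ ^ 2))
    have : 0 < K * (3 * κ ^ 2 + 1) := by positivity
    linarith
  obtain ⟨h1, h3, h4⟩ := hdual σ u w (fun i => (ξ i : ℝ)) s (ρ ^ 2) (κ * (M * ρ ^ 2))
    (3 * κ ^ 2 * (M * ρ)) P hσ hx.1 (hδ ▸ hx.2) hξ hw hV hs0 hsW hP0 hP1 hP2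
  refine ⟨hPM.trans (by gcongr; linarith), ⟨fun i => ?_, ?_⟩, fun i => ?_⟩
  · rw [Int.cast_abs]
    exact Icc_inv_subset (by linarith) (by linarith) (h1 i)
  · simp only [Int.cast_abs]
    refine h3.trans ?_
    have hQ : 1 ≤ G * M / P := by rwa [le_div_iff₀ hP0, one_mul]
    have e1 : ρ ^ 2 ≤ ρ ^ 2 * (G * M / P) ^ 2 := le_mul_of_one_le_right (by positivity)
      (one_le_pow₀ hQ)
    have e2 : κ * (M * ρ ^ 2) / P ≤ κ * (M * ρ ^ 2) / P * (G * M / P) :=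
      le_mul_of_one_le_right (by positivity) hQ
    have e3 : 0 ≤ (M * ρ) ^ 2 / P / P := by positivity
    calc _ ≤ C₀ * (ρ ^ 2 * (G * M / P) ^ 2 + κ * (M * ρ ^ 2) / P * (G * M / P) +
          (3 * κ ^ 2 * (M * ρ)) ^ 2 / P ^ 2) := by gcongr
      _ = C₀ * (G ^ 2 + κ * G + 9 * κ ^ 4) * ((M * ρ) ^ 2 / P / P) := by field_simp; ring
      _ ≤ C * ((M * ρ) ^ 2 / P / P) := by
        refine mul_le_mul_of_nonneg_right ?_ e3
        linarith
      _ = _ := by ring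
  · have h5 : u i / u 3 = (x i : ℝ) / x 3 := by
      simp only [hu]
      rw [div_div_div_cancel_right₀ hL.ne']
    rw [← h5]
    refine (h4 i).trans ?_
    rw [mul_div_assoc, ← mul_assoc]
    gcongr
    linarith

theorem exists_sum_card_dualPoint_le {α α' β : ℝ} (hαα : (α - 1) * (α' - 1) = 1) (hβ : 2 < β)
    {σ : Fin 4 → ℝ} (hσ : ∀ i, |σ i| = 1) (hbound : HasBound σ α' β) {κ : ℝ} (hκ : 1 ≤ κ) :
    ∃ C : ℝ, 0 < C ∧ ∀ (L M ρ : ℝ) (T : Finset (ℤ × ℤ)) (X : ℤ × ℤ → Fin 4 → ℤ)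
      (B : ℤ × ℤ → Finset (Fin 4 → ℤ)), 0 < L → 0 < M → M ≤ L → 0 < ρ → ρ ≤ 1 →
      L * M * ρ ^ 2 = 1 → (∀ τ ∈ T, X τ ∈ nearSet σ α κ L (1 / M)) →
      (∀ τ ∈ T, |(X τ 0 : ℝ) / X τ 3 / ρ - τ.1| ≤ 1) →
      (∀ τ ∈ T, |(X τ 1 : ℝ) / X τ 3 / ρ - τ.2| ≤ 1) →
      (∀ τ ∈ T, ∀ ξ ∈ B τ, IsDualPoint σ α κ L M ρ (X τ) ξ) →
      ∑ τ ∈ T, ((B τ).card : ℝ) ≤ C * (T.card + M ^ β) := by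
  classical
  obtain ⟨C₀, hC₀, hcases⟩ := exists_isDualPoint_cases hαα hκ
  obtain ⟨C₁, hC₁, hnear⟩ := hbound C₀ hC₀
  obtain ⟨C₂, hC₂, hgeom⟩ := exists_sum_two_pow_rpow_le (sub_pos.mpr hβ)
  have hC₀0 : 0 < C₀ := by linarith
  set c := 16 * (C₁ * (C₀ + 1)) * (5 * C₀) ^ 2 with hc
  have hc0 : 0 < c := by positivity
  refine ⟨(2 * C₀ + 1) ^ 4 + c * (C₂ * C₀ ^ (β - 2)), by positivity, ?_⟩
  intro L M ρ T X B hL hM hML hρ hρ1 hLM hX hX0 hX1 hB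
  have hMρ : 0 < M * ρ := by positivity
  have hMρ1 : (M * ρ) ^ 2 ≤ 1 := by
    rw [← hLM]
    nlinarith [mul_le_mul_of_nonneg_left hML (by positivity : 0 ≤ M * ρ ^ 2)]
  let small : (Fin 4 → ℤ) → Prop := fun ξ => ∀ i, |(ξ i : ℝ)| ≤ C₀
  let lev : (Fin 4 → ℤ) → ℕ := fun ξ => Nat.log 2 (ξ 3).natAbs
  set E : Finset (Σ _ : ℤ × ℤ, Fin 4 → ℤ) := T.sigma fun τ => (B τ).filter fun ξ => ¬ small ξ
    with hE
  have hsplit : ∑ τ ∈ T, ((B τ).card : ℝ) ≤ T.card * (2 * C₀ + 1) ^ 4 + E.card := by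
    rw [hE, Finset.card_sigma, Nat.cast_sum, ← nsmul_eq_mul, ← Finset.sum_const,
      ← Finset.sum_add_distrib]
    refine Finset.sum_le_sum fun τ _ => ?_
    rw [← Finset.card_filter_add_card_filter_not (s := B τ) small, Nat.cast_add]
    gcongr
    exact card_pi_int_le_of_abs_le hC₀0.le fun ξ hξ => (Finset.mem_filter.mp hξ).2
  have hEmem {e : Σ _ : ℤ × ℤ, Fin 4 → ℤ} (he : e ∈ E) : e.1 ∈ T ∧
      (2 : ℝ) ^ lev e.2 ≤ C₀ * M ∧
      (fun i => |e.2 i|) ∈ nearSet σ α' C₀ (2 ^ lev e.2) (C₀ * (M * ρ) ^ 2 / 2 ^ lev e.2) ∧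
      ∀ i, |(X e.1 i : ℝ) / X e.1 3 - (|(e.2 i : ℝ)| / |(e.2 3 : ℝ)|) ^ (α' - 1)| ≤
        C₀ * (M * ρ / 2 ^ lev e.2) := by
    obtain ⟨h1, h2⟩ := Finset.mem_sigma.mp he
    obtain ⟨h2, h3⟩ := Finset.mem_filter.mp h2
    exact ⟨h1, (hcases σ L M ρ (X e.1) e.2 hσ hL hM hML hρ hρ1 hLM (hX _ h1)
      (hB _ h1 _ h2)).resolve_left h3⟩
  have hlevel (j : ℕ) (hj : (2 : ℝ) ^ j ≤ C₀ * M) :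
      ((E.filter fun e => lev e.2 = j).card : ℝ) ≤ c * (M ^ 2 * ((2 : ℝ) ^ j) ^ (β - 2)) := by
    set P : ℝ := 2 ^ j with hP
    have hP0 : 0 < P := by positivity
    have hP1 : 1 ≤ P := one_le_pow₀ one_le_two
    set Ej := E.filter fun e => lev e.2 = j with hEj
    have hEjmem {e} (he : e ∈ Ej) : e ∈ E ∧ lev e.2 = j := Finset.mem_filter.mp he
    have himage : ((Ej.image Sigma.snd).card : ℝ) ≤ 16 * (C₁ * (C₀ + 1) * P ^ β) := by
      have h1 : ((Ej.image Sigma.snd).card : ℝ) ≤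
          ((16 * (nearSet σ α' C₀ P (C₀ * (M * ρ) ^ 2 / P)).ncard : ℕ) : ℝ) := by
        refine Nat.cast_le.mpr (card_le_of_abs_mem (nearSet_finite σ α' _ hC₀ hP0) fun ξ hξ => ?_)
        obtain ⟨e, he, rfl⟩ := Finset.mem_image.mp hξ
        have h := (hEmem (hEjmem he).1).2.2.1
        rwa [(hEjmem he).2] at h
      refine h1.trans ?_
      rw [Nat.cast_mul]
      push_cast
      gcongr
      refine (hnear P _ hP1 (by positivity)).trans ?_
      rw [mul_assoc]
      gcongr
      have h2 : C₀ * (M * ρ) ^ 2 / P * P ^ 3 = C₀ * (M * ρ) ^ 2 * P ^ 2 := by field_simp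
      have h3 : P ^ 2 ≤ P ^ β := by
        rw [← Real.rpow_two]
        exact Real.rpow_le_rpow_of_exponent_le hP1 hβ.le
      rw [h2, add_mul, one_mul]
      gcongr
      exact mul_le_of_le_one_right hC₀0.le hMρ1
    have hfiber (ξ : Fin 4 → ℤ) (hξ : ξ ∈ Ej.image Sigma.snd) :
        ((Ej.filter fun e => e.2 = ξ).card : ℝ) ≤ (5 * C₀ * (M / P)) ^ 2 := by
      have hQ : 1 ≤ C₀ * (M / P) := by
        rw [← mul_div_assoc, le_div_iff₀ hP0, one_mul]
        exact hj
      have hinj : ((Ej.filter fun e => e.2 = ξ).image Sigma.fst).card =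
          (Ej.filter fun e => e.2 = ξ).card := by
        refine Finset.card_image_of_injOn fun e he e' he' h => ?_
        have h1 := (Finset.mem_filter.mp he).2
        have h2 := (Finset.mem_filter.mp he').2
        exact Sigma.ext h (heq_of_eq (h1.trans h2.symm))
      rw [← hinj]
      have hclose (i : Fin 4) (f : ℤ × ℤ → ℤ)
          (hf : ∀ τ ∈ T, |(X τ i : ℝ) / X τ 3 / ρ - f τ| ≤ 1) :
          ∀ τ ∈ (Ej.filter fun e => e.2 = ξ).image Sigma.fst,
            |(f τ : ℝ) - (|(ξ i : ℝ)| / |(ξ 3 : ℝ)|) ^ (α' - 1) / ρ| ≤ 1 + C₀ * (M / P) := by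
        intro τ hτ
        obtain ⟨e, he, rfl⟩ := Finset.mem_image.mp hτ
        obtain ⟨hej, rfl⟩ := Finset.mem_filter.mp he
        obtain ⟨hT, -, -, h⟩ := hEmem (hEjmem hej).1
        have h1 := h i
        rw [(hEjmem hej).2, ← hP] at h1
        have h2 : |(X e.1 i : ℝ) / X e.1 3 / ρ - (|(e.2 i : ℝ)| / |(e.2 3 : ℝ)|) ^ (α' - 1) / ρ| ≤
            C₀ * (M / P) := by
          rw [← sub_div, abs_div, abs_of_pos hρ, div_le_iff₀ hρ]
          refine h1.trans (le_of_eq ?_)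
          ring
        have h3 := hf e.1 hT
        rw [abs_sub_comm] at h3
        exact (abs_sub_le _ _ _).trans (add_le_add h3 h2)
      refine (card_int_prod_le_of_abs_sub_le (by positivity) (hclose 0 Prod.fst hX0)
        (hclose 1 Prod.snd hX1)).trans ?_
      gcongr
      linarith
    calc (Ej.card : ℝ) = ∑ ξ ∈ Ej.image Sigma.snd, ((Ej.filter fun e => e.2 = ξ).card : ℝ) := by
          exact_mod_cast Finset.card_eq_sum_card_image Sigma.snd Ej
      _ ≤ ∑ _ξ ∈ Ej.image Sigma.snd, (5 * C₀ * (M / P)) ^ 2 := Finset.sum_le_sum hfiber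
      _ = (Ej.image Sigma.snd).card * (5 * C₀ * (M / P)) ^ 2 := by
          rw [Finset.sum_const, nsmul_eq_mul]
      _ ≤ 16 * (C₁ * (C₀ + 1) * P ^ β) * (5 * C₀ * (M / P)) ^ 2 := by gcongr
      _ = _ := by
          rw [Real.rpow_sub hP0, Real.rpow_two, hc]
          field_simp
  have hEcard : (E.card : ℝ) ≤ c * (C₂ * C₀ ^ (β - 2)) * M ^ β := by
    calc (E.card : ℝ) = ∑ j ∈ E.image (fun e => lev e.2),
          ((E.filter fun e => lev e.2 = j).card : ℝ) := by
          exact_mod_cast Finset.card_eq_sum_card_image (fun e => lev e.2) E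
      _ ≤ ∑ j ∈ E.image (fun e => lev e.2), c * (M ^ 2 * ((2 : ℝ) ^ j) ^ (β - 2)) := by
          refine Finset.sum_le_sum fun j hj => hlevel j ?_
          obtain ⟨e, he, rfl⟩ := Finset.mem_image.mp hj
          exact (hEmem he).2.1
      _ = c * M ^ 2 * ∑ j ∈ E.image (fun e => lev e.2), ((2 : ℝ) ^ j) ^ (β - 2) := by
          rw [Finset.mul_sum]
          refine Finset.sum_congr rfl fun j _ => ?_
          ring
      _ ≤ c * M ^ 2 * (C₂ * (C₀ * M) ^ (β - 2)) := by
          gcongr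
          refine hgeom (C₀ * M) _ (by positivity) fun j hj => ?_
          obtain ⟨e, he, rfl⟩ := Finset.mem_image.mp hj
          exact (hEmem he).2.1
      _ = _ := by
          rw [Real.mul_rpow hC₀0.le hM.le, Real.rpow_sub hM, Real.rpow_two]
          field_simp
  have hMβ : 0 ≤ M ^ β := by positivity
  have hT0 : (0 : ℝ) ≤ T.card := by positivity
  have q1 : 0 ≤ (2 * C₀ + 1) ^ 4 * M ^ β := by positivity
  have q2 : 0 ≤ c * (C₂ * C₀ ^ (β - 2)) * T.card := by positivity
  linarith

theorem finite_setOf_isDualPoint (σ : Fin 4 → ℝ) (α κ L M ρ : ℝ) (x : Fin 4 → ℤ) :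
    {ξ | IsDualPoint σ α κ L M ρ x ξ}.Finite := by
  refine finite_pi_int_of_abs_le
    (M * ∑ i, |σ i * ((x i : ℝ) / L) ^ (α - 1)| + 3 * κ ^ 2 * (M * ρ)) ?_
  rintro ξ ⟨s, w, hs, hw, -, hξ⟩ i
  rw [hξ]
  refine (abs_add_le _ _).trans (add_le_add ?_ (hw i))
  rw [abs_mul]
  exact mul_le_mul hs (Finset.single_le_sum
    (f := fun i => |σ i * ((x i : ℝ) / L) ^ (α - 1)|) (fun _ _ => abs_nonneg _)
    (Finset.mem_univ i)) (abs_nonneg _) ((abs_nonneg _).trans hs)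

theorem exists_ncard_nearSet_le {α α' β : ℝ} (hαα : (α - 1) * (α' - 1) = 1) (hα : α ≠ 0)
    (hβ : 2 < β) {σ : Fin 4 → ℝ} (hσ : ∀ i, |σ i| = 1) (hbound : HasBound σ α' β) {κ : ℝ}
    (hκ : 1 ≤ κ) :
    ∃ C : ℝ, 0 < C ∧ ∀ L M : ℝ, 1 ≤ L → 1 / L ≤ M → M ≤ L →
      ((nearSet σ α κ L (1 / M)).ncard : ℝ) ≤ C * (L ^ 3 / M + L ^ 2 * M ^ (β - 2)) := by
  classical
  obtain ⟨C₁, hC₁, hcell⟩ := exists_cell_bound hα hκ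
  obtain ⟨C₂, hC₂, hdual⟩ := exists_sum_card_dualPoint_le hαα hβ hσ hbound hκ
  have hκ0 : 0 < κ := by linarith
  refine ⟨C₁ * C₂ * (9 * κ ^ 4), by positivity, fun L M hL hLM hML => ?_⟩
  have hL0 : 0 < L := by linarith
  have hM0 : 0 < M := (by positivity : 0 < 1 / L).trans_le hLM
  have hLM1 : 1 ≤ L * M := by rwa [div_le_iff₀' hL0] at hLM
  set ρ := (√(L * M))⁻¹ with hρdef
  have hρ : 0 < ρ := by positivity
  have hρ1 : ρ ≤ 1 := inv_le_one_of_one_le₀ (Real.one_le_sqrt.mpr hLM1)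
  have hρ2 : L * M * ρ ^ 2 = 1 := by
    rw [hρdef, inv_pow, Real.sq_sqrt (by positivity)]
    exact mul_inv_cancel₀ (by positivity)
  have hfin := nearSet_finite σ α (1 / M) hκ hL0
  set N := hfin.toFinset with hN
  have hmem {x} : x ∈ N ↔ x ∈ nearSet σ α κ L (1 / M) := hfin.mem_toFinset
  let cell : (Fin 4 → ℤ) → ℤ × ℤ := fun x =>
    (⌊(x 0 : ℝ) / x 3 / ρ⌋, ⌊(x 1 : ℝ) / x 3 / ρ⌋)
  set T := N.image cell with hT
  set X : ℤ × ℤ → Fin 4 → ℤ := Function.invFunOn cell N with hX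
  have hex {τ} (hτ : τ ∈ T) : ∃ x ∈ (N : Set (Fin 4 → ℤ)), cell x = τ := Finset.mem_image.mp hτ
  have hXN {τ} (hτ : τ ∈ T) : X τ ∈ nearSet σ α κ L (1 / M) :=
    hmem.mp (Function.invFunOn_mem (hex hτ))
  have hXτ {τ} (hτ : τ ∈ T) : cell (X τ) = τ := Function.invFunOn_eq (hex hτ)
  have hfloor (z : ℝ) : |z - ⌊z⌋| ≤ 1 := by
    rw [← Int.fract, abs_of_nonneg (Int.fract_nonneg z)]
    exact (Int.fract_lt_one z).le
  have hratio {x y : Fin 4 → ℤ} {i : Fin 4}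
      (h : ⌊(y i : ℝ) / y 3 / ρ⌋ = ⌊(x i : ℝ) / x 3 / ρ⌋) :
      |(y i : ℝ) / y 3 - x i / x 3| ≤ ρ := by
    have h1 := (Int.abs_sub_lt_one_of_floor_eq_floor h).le
    rwa [← sub_div, abs_div, abs_of_pos hρ, div_le_one hρ] at h1
  set B : ℤ × ℤ → Finset (Fin 4 → ℤ) := fun τ =>
    (finite_setOf_isDualPoint σ α κ L M ρ (X τ)).toFinset with hB
  have hfiber (τ) (hτ : τ ∈ T) :
      ((N.filter fun y => cell y = τ).card : ℝ) ≤ C₁ * (L ^ 2 / M ^ 2) * (B τ).card := by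
    have hy {y} (hy : y ∈ N.filter fun y => cell y = τ) : y ∈ N ∧ cell y = cell (X τ) := by
      rw [hXτ hτ]
      exact Finset.mem_filter.mp hy
    exact hcell σ L M ρ (X τ) _ (B τ) hσ hL0 hM0 hρ hρ1 hρ2 (hXN hτ)
      (fun y h => hmem.mp (hy h).1) (fun y h => hratio (congrArg Prod.fst (hy h).2))
      (fun y h => hratio (congrArg Prod.snd (hy h).2)) fun ξ hξ => by simpa [hB] using hξ
  have hsum := hdual L M ρ T X B hL0 hM0 hML hρ hρ1 hρ2 (fun τ hτ => hXN hτ)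
    (fun τ hτ => by
      have hfl : ⌊(X τ 0 : ℝ) / X τ 3 / ρ⌋ = τ.1 := congrArg Prod.fst (hXτ hτ)
      exact hfl ▸ hfloor _)
    (fun τ hτ => by
      have hfl : ⌊(X τ 1 : ℝ) / X τ 3 / ρ⌋ = τ.2 := congrArg Prod.snd (hXτ hτ)
      exact hfl ▸ hfloor _)
    (fun τ _ ξ hξ => by simpa [hB] using hξ)
  have hTcard : (T.card : ℝ) ≤ 9 * κ ^ 4 * (L * M) := by
    have hclose (i : Fin 4) {x} (hx : x ∈ N) : |(⌊(x i : ℝ) / x 3 / ρ⌋ : ℝ) - 0| ≤ κ ^ 2 / ρ := by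
      have h1 := div_mem_Icc_inv hκ0 hκ0 ((hmem.mp hx).1 i) ((hmem.mp hx).1 3)
      rw [div_div_div_cancel_right₀ hL0.ne'] at h1
      have h2 : 0 ≤ (x i : ℝ) / x 3 / ρ :=
        div_nonneg (le_trans (by positivity) h1.1) hρ.le
      rw [sub_zero, abs_of_nonneg (by exact_mod_cast Int.floor_nonneg.mpr h2)]
      refine (Int.floor_le _).trans ?_
      rw [sq]
      exact div_le_div_of_nonneg_right h1.2 hρ.le
    refine (card_int_prod_le_of_abs_sub_le (c := 0) (d := 0) (D := κ ^ 2 / ρ) (by positivity)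
      (fun τ hτ => ?_) fun τ hτ => ?_).trans ?_
    · obtain ⟨x, hx, rfl⟩ := Finset.mem_image.mp hτ
      exact hclose 0 hx
    · obtain ⟨x, hx, rfl⟩ := Finset.mem_image.mp hτ
      exact hclose 1 hx
    · have h1 : 1 ≤ κ ^ 2 / ρ := by
        rw [le_div_iff₀ hρ, one_mul]
        exact hρ1.trans (one_le_pow₀ hκ)
      calc (2 * (κ ^ 2 / ρ) + 1) ^ 2 ≤ (3 * (κ ^ 2 / ρ)) ^ 2 := by gcongr; linarith
        _ = _ := by
          field_simp
          linear_combination (-9) * hρ2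
  calc ((nearSet σ α κ L (1 / M)).ncard : ℝ) = (N.card : ℝ) := by
        rw [Set.ncard_eq_toFinset_card _ hfin]
    _ = ∑ τ ∈ T, ((N.filter fun y => cell y = τ).card : ℝ) := by
        exact_mod_cast Finset.card_eq_sum_card_image cell N
    _ ≤ ∑ τ ∈ T, C₁ * (L ^ 2 / M ^ 2) * (B τ).card := Finset.sum_le_sum hfiber
    _ = C₁ * (L ^ 2 / M ^ 2) * ∑ τ ∈ T, ((B τ).card : ℝ) := by rw [Finset.mul_sum]
    _ ≤ C₁ * (L ^ 2 / M ^ 2) * (C₂ * (9 * κ ^ 4 * (L * M) + 9 * κ ^ 4 * M ^ β)) := by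
        refine mul_le_mul_of_nonneg_left (hsum.trans ?_) (by positivity)
        have h1 : M ^ β ≤ 9 * κ ^ 4 * M ^ β :=
          le_mul_of_one_le_left (by positivity) (by linarith [one_le_pow₀ hκ (n := 4)])
        gcongr
    _ = _ := by
        rw [Real.rpow_sub hM0, Real.rpow_two]
        field_simp

theorem HasBound.dual {α α' β : ℝ} (hαα : (α - 1) * (α' - 1) = 1) (hα : α ≠ 0) (hβ : 2 < β)
    {σ : Fin 4 → ℝ} (hσ : ∀ i, |σ i| = 1) (hbound : HasBound σ α' β) :
    HasBound σ α (3 - 1 / (β - 1)) := by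
  intro κ hκ
  obtain ⟨C, hC, h⟩ := exists_ncard_nearSet_le hαα hα hβ hσ hbound hκ
  have hκ0 : 0 < κ := by linarith
  refine ⟨81 * κ ^ 4 + 2 * C, by positivity, fun L δ hL hδ => ?_⟩
  have hL0 : 0 < L := by linarith
  have hβ1 : 0 < β - 1 := by linarith
  set η := 1 / (β - 1) with hη
  have hη0 : 0 < η := by positivity
  have hη1 : η ≤ 1 := by
    rw [hη, div_le_one hβ1]
    linarith
  have p1 : 0 ≤ C * (δ * L ^ 3) := by positivity
  have p2 : 0 ≤ κ ^ 4 * (δ * L ^ 3) := by positivity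
  have p3 : 0 ≤ C * L ^ (3 - η) := by positivity
  have p4 : 0 ≤ κ ^ 4 * L ^ (3 - η) := by positivity
  rcases le_total L δ with hδL | hδL
  · have h1 : L ^ 4 ≤ δ * L ^ 3 := by
      rw [pow_succ']
      gcongr
    have h2 := mul_le_mul_of_nonneg_left h1 (by positivity : 0 ≤ κ ^ 4)
    linarith [ncard_nearSet_le σ α δ hκ hL]
  · set δ₀ := max δ (L ^ (-η)) with hδ₀
    have hd : 0 < δ₀ := hδ.trans_le (le_max_left _ _)
    have hdL : δ₀ ≤ L := max_le hδL
      ((Real.rpow_le_one_of_one_le_of_nonpos hL (by linarith)).trans hL)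
    have hd1 : 1 / δ₀ ≤ L ^ η := by
      rw [one_div, ← inv_inv (L ^ η), ← Real.rpow_neg hL0.le]
      exact inv_anti₀ (by positivity) (le_max_right _ _)
    have hd2 : L ^ η ≤ L := by
      simpa using Real.rpow_le_rpow_of_exponent_le hL hη1
    have hpow : (1 / δ₀) ^ (β - 2) ≤ L * δ₀ := by
      have h1 : (1 / δ₀) ^ (β - 1) ≤ L := by
        refine (Real.rpow_le_rpow (by positivity) hd1 hβ1.le).trans ?_
        rw [← Real.rpow_mul hL0.le, hη, one_div_mul_cancel hβ1.ne', Real.rpow_one]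
      have h2 : (1 / δ₀) ^ (β - 2) = (1 / δ₀) ^ (β - 1) * δ₀ := by
        rw [show β - 2 = β - 1 - 1 by ring, Real.rpow_sub_one (by positivity)]
        field_simp
      rw [h2]
      gcongr
    have hsub : ((nearSet σ α κ L δ).ncard : ℝ) ≤ ((nearSet σ α κ L δ₀).ncard : ℝ) :=
      Nat.cast_le.mpr (Set.ncard_le_ncard (nearSet_mono σ α κ hL0 (le_max_left _ _))
        (nearSet_finite σ α δ₀ hκ hL0))
    have hb := h L (1 / δ₀) hL (one_div_le_one_div_of_le hd hdL) (hd1.trans hd2)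
    rw [one_div_one_div] at hb
    have hL3 : L ^ (-η) * L ^ 3 = L ^ (3 - η) := by
      rw [← Real.rpow_natCast L 3, ← Real.rpow_add hL0]
      congr 1
      push_cast
      ring
    have hδ₀L : δ₀ * L ^ 3 ≤ δ * L ^ 3 + L ^ (3 - η) := by
      rw [← hL3, ← add_mul]
      gcongr
      exact max_le_add_of_nonneg hδ.le (by positivity)
    have hfin : C * (L ^ 3 / (1 / δ₀) + L ^ 2 * (1 / δ₀) ^ (β - 2)) ≤
        2 * C * (δ * L ^ 3 + L ^ (3 - η)) := by
      calc _ ≤ C * (L ^ 3 / (1 / δ₀) + L ^ 2 * (L * δ₀)) := by gcongr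
        _ = 2 * C * (δ₀ * L ^ 3) := by field_simp; ring
        _ ≤ _ := by gcongr
    linarith

theorem hasBound_two_add_two_div {σ : Fin 4 → ℝ} (hσ : ∀ i, |σ i| = 1) (k : ℕ) :
    HasBound σ (1 / 2) (2 + 2 / (2 * k + 1)) ∧ HasBound σ (-1) (2 + 2 / (2 * k + 1)) := by
  induction k with
  | zero => norm_num [hasBound_four]
  | succ k ih =>
    have hk : (0 : ℝ) < 2 * k + 1 := by positivity
    have hβ : (2 : ℝ) < 2 + 2 / (2 * k + 1) := lt_add_of_pos_right _ (by positivity)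
    have hstep : (2 : ℝ) + 2 / (2 * ((k + 1 : ℕ) : ℝ) + 1) =
        3 - 1 / (2 + 2 / (2 * k + 1) - 1) := by
      have : (2 : ℝ) + 2 / (2 * k + 1) - 1 = (2 * k + 3) / (2 * k + 1) := by
        field_simp
        ring
      rw [this]
      push_cast
      field_simp
      ring
    rw [hstep]
    exact ⟨ih.2.dual (by norm_num) (by norm_num) hβ hσ,
      ih.1.dual (by norm_num) (by norm_num) hβ hσ⟩

theorem HasBound.mono {σ : Fin 4 → ℝ} {α β β' : ℝ} (h : HasBound σ α β) (hβ : β ≤ β') :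
    HasBound σ α β' := by
  intro κ hκ
  obtain ⟨C, hC, h⟩ := h κ hκ
  refine ⟨C, hC, fun L δ hL hδ => (h L δ hL hδ).trans ?_⟩
  gcongr

theorem hasBound_sqrt {σ : Fin 4 → ℝ} (hσ : ∀ i, |σ i| = 1) {ε : ℝ} (hε : 0 < ε) :
    HasBound σ (1 / 2) (2 + ε) := by
  obtain ⟨k, hk⟩ := exists_nat_gt (1 / ε)
  refine (hasBound_two_add_two_div hσ k).1.mono ?_
  gcongr
  rw [div_lt_iff₀ hε] at hk
  rw [div_le_iff₀ (by positivity)]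
  linarith

/-- Quadruples of integers in `(L, 2L]` with `|√a + √b - √c - √d| < Δ`. -/
def sqrtQuadruples (L Δ : ℝ) : Set (ℤ × ℤ × ℤ × ℤ) :=
  {t | (L < (t.1 : ℝ) ∧ (t.1 : ℝ) ≤ 2*L) ∧
    (L < (t.2.1 : ℝ) ∧ (t.2.1 : ℝ) ≤ 2*L) ∧
    (L < (t.2.2.1 : ℝ) ∧ (t.2.2.1 : ℝ) ≤ 2*L) ∧
    (L < (t.2.2.2 : ℝ) ∧ (t.2.2.2 : ℝ) ≤ 2*L) ∧
    |Real.sqrt (t.1 : ℝ) + Real.sqrt (t.2.1 : ℝ)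
      - Real.sqrt (t.2.2.1 : ℝ) - Real.sqrt (t.2.2.2 : ℝ)| < Δ}

theorem ncard_sqrtQuadruples_le_ncard_nearSet {L : ℝ} (Δ : ℝ) (hL : 0 < L) :
    (sqrtQuadruples L Δ).ncard ≤ (nearSet ![1, 1, -1, -1] (1 / 2) 2 L (Δ * √L)).ncard := by
  refine Set.ncard_le_ncard_of_injOn (fun t => ![t.1, t.2.1, t.2.2.1, t.2.2.2]) ?_ ?_
    (nearSet_finite _ _ _ one_le_two hL)
  · rintro ⟨a, b, c, d⟩ ⟨ha, hb, hc, hd, h⟩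
    have hbox {n : ℤ} (hn : L < (n : ℝ) ∧ (n : ℝ) ≤ 2 * L) : (n : ℝ) / L ∈ Set.Icc 2⁻¹ 2 := by
      rw [Set.mem_Icc, le_div_iff₀ hL, div_le_iff₀ hL]
      exact ⟨by linarith, hn.2⟩
    refine ⟨fun i => ?_, ?_⟩
    · fin_cases i
      exacts [hbox ha, hbox hb, hbox hc, hbox hd]
    · have hsq (n : ℤ) : ((n : ℝ) / L) ^ (1 / 2 : ℝ) = √n / √L := by
        rw [← Real.sqrt_eq_rpow, Real.sqrt_div' _ hL.le]
      have hsum : ∑ i, (![1, 1, -1, -1] : Fin 4 → ℝ) i *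
          (((![a, b, c, d] : Fin 4 → ℤ) i : ℝ) / L) ^ (1 / 2 : ℝ) =
          (√a + √b - √c - √d) / √L := by
        rw [Fin.sum_univ_four]
        simp only [Matrix.cons_val, hsq]
        ring
      have hrhs : Δ * √L / L = Δ / √L := by
        rw [mul_div_assoc, Real.sqrt_div_self, ← div_eq_mul_inv]
      change |∑ i, (![1, 1, -1, -1] : Fin 4 → ℝ) i *
          (((![a, b, c, d] : Fin 4 → ℤ) i : ℝ) / L) ^ (1 / 2 : ℝ)| ≤ _
      rw [hsum, hrhs, abs_div, abs_of_pos (Real.sqrt_pos.mpr hL)]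
      gcongr
  · rintro ⟨a, b, c, d⟩ - ⟨a', b', c', d'⟩ - h
    have h0 := congrFun h 0
    have h1 := congrFun h 1
    have h2 := congrFun h 2
    have h3 := congrFun h 3
    simp only [Matrix.cons_val] at h0 h1 h2 h3
    rw [h0, h1, h2, h3]

theorem ncard_sqrtQuadruples_le_one {L : ℝ} (Δ : ℝ) (hL : 1 / 2 ≤ L) (hL1 : L < 1) :
    (sqrtQuadruples L Δ).ncard ≤ 1 := by
  rw [← Set.ncard_singleton ((1, 1, 1, 1) : ℤ × ℤ × ℤ × ℤ)]
  refine Set.ncard_le_ncard ?_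
  rintro ⟨a, b, c, d⟩ ⟨ha, hb, hc, hd, -⟩
  have hone {n : ℤ} (hn : L < (n : ℝ) ∧ (n : ℝ) ≤ 2 * L) : n = 1 := by
    have h1 : (0 : ℝ) < n := by linarith
    have h2 : (n : ℝ) < 2 := by linarith
    have h3 : 0 < n := by exact_mod_cast h1
    have h4 : n < 2 := by exact_mod_cast h2
    omega
  obtain rfl := hone ha
  obtain rfl := hone hb
  obtain rfl := hone hc
  obtain rfl := hone hd
  rfl

theorem exists_ncard_sqrtQuadruples_le {ε : ℝ} (hε : 0 < ε) :
    ∃ C : ℝ, 0 < C ∧ ∀ L Δ : ℝ, 1 / 2 ≤ L → 0 < Δ →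
      ((sqrtQuadruples L Δ).ncard : ℝ) ≤ C * (L ^ ((7 : ℝ)/2 + ε) * Δ + L ^ (2 + ε)) := by
  have hσ (i : Fin 4) : |(![1, 1, -1, -1] : Fin 4 → ℝ) i| = 1 := by fin_cases i <;> simp
  obtain ⟨C, hC, h⟩ := hasBound_sqrt hσ hε 2 one_le_two
  refine ⟨C + 2 ^ (2 + ε), by positivity, fun L Δ hL hΔ => ?_⟩
  have hL0 : 0 < L := by linarith
  have p1 : 0 ≤ L ^ ((7 : ℝ) / 2 + ε) * Δ := by positivity
  rcases lt_or_ge L 1 with hL1 | hL1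
  · have h1 : ((sqrtQuadruples L Δ).ncard : ℝ) ≤ 1 := by
      exact_mod_cast ncard_sqrtQuadruples_le_one Δ hL hL1
    have h2 : (1 : ℝ) ≤ 2 ^ (2 + ε) * L ^ (2 + ε) := by
      rw [← Real.mul_rpow zero_le_two hL0.le]
      exact Real.one_le_rpow (by linarith) (by positivity)
    refine h1.trans (h2.trans ?_)
    gcongr
    · exact le_add_of_nonneg_left hC.le
    · exact le_add_of_nonneg_left p1
  · have h1 : ((sqrtQuadruples L Δ).ncard : ℝ) ≤
        ((nearSet ![1, 1, -1, -1] (1 / 2) 2 L (Δ * √L)).ncard : ℝ) := by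
      exact_mod_cast ncard_sqrtQuadruples_le_ncard_nearSet Δ hL0
    have h2 : Δ * √L * L ^ 3 ≤ L ^ ((7 : ℝ) / 2 + ε) * Δ := by
      have h3 : √L * L ^ 3 = L ^ ((7 : ℝ) / 2) := by
        rw [Real.sqrt_eq_rpow, ← Real.rpow_natCast L 3, ← Real.rpow_add hL0]
        norm_num
      rw [mul_assoc, h3, mul_comm]
      gcongr
      linarith
    refine h1.trans ((h L _ hL1 (by positivity)).trans ?_)
    gcongr
    exact le_add_of_nonneg_right (by positivity)

/-- Corollary (spacing of square roots): the number of quadruples `⟨a,b,c,d⟩` of integers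
in `(L,2L]` with `|√a + √b − √c − √d| < k M^{ϑ−1/2}` is `≪ L^{7/2+ε} k M^{ϑ−1/2} + L^{2+ε}`,
uniformly in `M, L, ϑ, k`. -/
theorem spacing_of_square_roots (ε : ℝ) (hε : 0 < ε) :
    ∃ C : ℝ, 0 < C ∧ ∀ (M L ϑ : ℝ) (k : ℕ),
      1 ≤ M → (1 : ℝ)/2 ≤ L → 0 < ϑ → 0 < k →
      ({t : ℤ × ℤ × ℤ × ℤ |
          (L < (t.1 : ℝ) ∧ (t.1 : ℝ) ≤ 2*L) ∧
          (L < (t.2.1 : ℝ) ∧ (t.2.1 : ℝ) ≤ 2*L) ∧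
          (L < (t.2.2.1 : ℝ) ∧ (t.2.2.1 : ℝ) ≤ 2*L) ∧
          (L < (t.2.2.2 : ℝ) ∧ (t.2.2.2 : ℝ) ≤ 2*L) ∧
          |Real.sqrt (t.1 : ℝ) + Real.sqrt (t.2.1 : ℝ)
            - Real.sqrt (t.2.2.1 : ℝ) - Real.sqrt (t.2.2.2 : ℝ)|
            < (k : ℝ) * M ^ (ϑ - 1/2)}.ncard : ℝ)
        ≤ C * (L ^ ((7 : ℝ)/2 + ε) * (k : ℝ) * M ^ (ϑ - 1/2) + L ^ (2 + ε)) := by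
  obtain ⟨C, hC, h⟩ := exists_ncard_sqrtQuadruples_le hε
  refine ⟨C, hC, fun M L ϑ k hM hL _ hk => ?_⟩
  rw [mul_assoc (L ^ ((7 : ℝ) / 2 + ε))]
  have hk0 : (0 : ℝ) < k := by exact_mod_cast hk
  exact h L (k * M ^ (ϑ - 1 / 2)) hL (by positivity)
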